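/- arXiv:0812.3998 — 6 statements merged into one kernel-verified Lean document; each statement's English description precedes it below -/
import Mathlib

section
/- Let n be a positive integer, M > 1 a real number, and let (t_r)_{r≥1} be a sequence of positive reals satisfying the lacunarity condition t_{r+1}/t_r ≥ M for all r ≥ 1. Let (u^{(r)})_{r≥1} be a sequence of nonzero integer vectors u^{(r)} = (u_1^{(r)}, …, u_n^{(r)}) ∈ ℤ^n with t_r² = (u_1^{(r)})² + ⋯ + (u_n^{(r)})² for all r. Then the set N(Λ) = {η = (η_1,…,η_n) ∈ ℝ^n : there exists c(η) > 0 such that ‖u_1^{(r)} η_1 + ⋯ + u_n^{(r)} η_n‖ ≥ c(η) for all r ∈ ℕ} is nonempty. -/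
/-- Distance from a real number to the nearest integer. -/
noncomputable def dnint (t : ℝ) : ℝ := ⨅ k : ℤ, |t - (k : ℝ)|

open Finset in
lemma aux_window (S : Finset ℕ) (L : ℕ) (h : ∀ a ∈ S, ∀ b ∈ S, b < a + L) : S.card ≤ L := by
  rcases S.eq_empty_or_nonempty with rfl | hne
  · simp
  · have : S ⊆ Finset.Ico (S.min' hne) (S.min' hne + L) := by
      intro b hb
      rw [Finset.mem_Ico]
      exact ⟨S.min'_le b hb, h _ (S.min'_mem hne) b hb⟩
    simpa using Finset.card_le_card this

open Classical in
lemma aux_line (m L : ℕ) (A b w : ℝ) (hb : |b| * m ≤ 1 / 4) (hw : w ≤ 1 / 4)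
    (hL : 2 * w ≤ L * |b|) :
    (Finset.univ.filter (fun j : Fin m => ∃ k : ℤ, |A + b * (j : ℕ) - k| < w)).card ≤ L := by
  rw [← Finset.card_map Fin.valEmbedding]
  apply aux_window
  intro a ha c hc
  simp only [Finset.mem_map, Finset.mem_filter, Finset.mem_univ, true_and,
    Fin.valEmbedding_apply] at ha hc
  obtain ⟨a, ⟨k, hk⟩, rfl⟩ := ha
  obtain ⟨c, ⟨l, hl⟩, rfl⟩ := hc
  by_contra hcon
  push Not at hcon
  have hcon' : ((a : ℕ) : ℝ) + L ≤ ((c : ℕ) : ℝ) := by exact_mod_cast hcon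
  have hcm : ((c : ℕ) : ℝ) ≤ m := by exact_mod_cast c.2.le
  have ha0 : (0 : ℝ) ≤ ((a : ℕ) : ℝ) := by positivity
  have hL0 : (0 : ℝ) ≤ (L : ℝ) := by positivity
  have habs : |b * ((c : ℕ) - (a : ℕ) : ℝ)| = |b| * ((c : ℕ) - (a : ℕ) : ℝ) := by
    rw [abs_mul, abs_of_nonneg (by linarith : (0:ℝ) ≤ ((c : ℕ) - (a : ℕ) : ℝ))]
  have h1 : |b| * ((c : ℕ) - (a : ℕ) : ℝ) ≤ 1 / 4 :=
    le_trans (mul_le_mul_of_nonneg_left (by linarith) (abs_nonneg b)) hb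
  have h2 : (L : ℝ) * |b| ≤ |b| * ((c : ℕ) - (a : ℕ) : ℝ) := by
    rw [mul_comm]
    exact mul_le_mul_of_nonneg_left (by linarith) (abs_nonneg b)
  rw [← habs] at h1 h2
  have hk' := abs_lt.1 hk
  have hl' := abs_lt.1 hl
  have h1' := abs_le.1 h1
  have hkl : k = l := by
    have e1 : ((k : ℝ) - l) < 1 := by nlinarith
    have e2 : (-1 : ℝ) < ((k : ℝ) - l) := by nlinarith
    have e1' : k - l < 1 := by exact_mod_cast e1
    have e2' : -1 < k - l := by exact_mod_cast e2
    omega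
  subst hkl
  have : |b * ((c : ℕ) - (a : ℕ) : ℝ)| < 2 * w := by
    rw [abs_lt]
    constructor <;> nlinarith
  linarith

open Classical in
lemma aux_count {n m L : ℕ} (i : Fin n) (B : (Fin n → Fin m) → Prop)
    (h : ∀ p : Fin n → Fin m,
      (Finset.univ.filter (fun j : Fin m => B (Function.update p i j))).card ≤ L) :
    m * (Finset.univ.filter B).card ≤ L * Fintype.card (Fin n → Fin m) := by
  let R := {j : Fin n // j ≠ i} → Fin m
  let e : (Fin n → Fin m) ≃ Fin m × R := Equiv.funSplitAt i (Fin m)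
  have hc : Fintype.card (Fin n → Fin m) = m * Fintype.card R := by
    rw [Fintype.card_congr e, Fintype.card_prod, Fintype.card_fin]
  have h1 : (Finset.univ.filter B).card ≤ L * (Finset.univ : Finset R).card := by
    refine Finset.card_le_mul_card_image_of_maps_to (f := fun p => (e p).2)
      (fun _ _ => Finset.mem_univ _) L ?_
    intro q _
    rcases Finset.eq_empty_or_nonempty
      ((Finset.univ.filter B).filter (fun p => (e p).2 = q)) with he | ⟨p, hp⟩
    · rw [he]; simp
    · refine le_trans ?_ (h p)
      refine Finset.card_le_card_of_injOn (fun p' => p' i) ?_ ?_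
      · intro p' hp'
        have hp2 : (e p).2 = q := (Finset.mem_filter.1 hp).2
        have hp2' : (e p').2 = q := (Finset.mem_filter.1 hp').2
        have hB : B p' := (Finset.mem_filter.1 (Finset.mem_filter.1 hp').1).2
        have : Function.update p i (p' i) = p' := by
          ext1 j
          by_cases hj : j = i
          · subst hj; simp
          · rw [Function.update_of_ne hj]
            exact congrFun (hp2.trans hp2'.symm) ⟨j, hj⟩
        simp [this, hB]
      · intro p1 h1 p2 h2 h12
        have hp1 : (e p1).2 = q := (Finset.mem_filter.1 h1).2
        have hp2 : (e p2).2 = q := (Finset.mem_filter.1 h2).2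
        ext1 j
        by_cases hj : j = i
        · subst hj; exact h12
        · exact congrFun (hp1.trans hp2.symm) ⟨j, hj⟩
  rw [hc]
  calc m * (Finset.univ.filter B).card ≤ m * (L * (Finset.univ : Finset R).card) :=
        Nat.mul_le_mul_left _ h1
    _ = L * (m * Fintype.card R) := by rw [Finset.card_univ]; ring

open Classical in
lemma aux_exists {n m L : ℕ} (hm : 0 < m) (S : Finset ℕ) (hS : S.card * L < m)
    (B : ℕ → (Fin n → Fin m) → Prop)
    (h : ∀ r ∈ S, m * (Finset.univ.filter (B r)).card ≤ L * Fintype.card (Fin n → Fin m)) :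
    ∃ p, ∀ r ∈ S, ¬ B r p := by
  by_contra hcon
  push Not at hcon
  have : Nonempty (Fin m) := ⟨⟨0, hm⟩⟩
  have hpos : 0 < Fintype.card (Fin n → Fin m) := Fintype.card_pos
  have hsub : (Finset.univ : Finset (Fin n → Fin m)) ⊆
      S.biUnion (fun r => Finset.univ.filter (B r)) := by
    intro p _
    obtain ⟨r, hr, hb⟩ := hcon p
    simp only [Finset.mem_biUnion, Finset.mem_filter, Finset.mem_univ, true_and]
    exact ⟨r, hr, hb⟩
  have h1 := (Finset.card_le_card hsub).trans Finset.card_biUnion_le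
  have h2 : m * Fintype.card (Fin n → Fin m) ≤ S.card * (L * Fintype.card (Fin n → Fin m)) := by
    calc m * Fintype.card (Fin n → Fin m) ≤ m * ∑ r ∈ S, (Finset.univ.filter (B r)).card :=
          Nat.mul_le_mul_left _ h1
      _ = ∑ r ∈ S, m * (Finset.univ.filter (B r)).card := Finset.mul_sum _ _ _
      _ ≤ ∑ r ∈ S, L * Fintype.card (Fin n → Fin m) := Finset.sum_le_sum h
      _ = _ := by simp
  rw [← mul_assoc] at h2
  exact absurd (Nat.le_of_mul_le_mul_right h2 hpos) (by omega)

open Classical in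
lemma aux_step {n m : ℕ} (hn : 0 < n) (hm : 2 ≤ m) (t : ℕ → ℝ) (ht : ∀ r, 0 < t r)
    (u : ℕ → Fin n → ℤ)
    (hnorm : ∀ r, (t r) ^ 2 = ∑ i : Fin n, ((u r i : ℝ)) ^ 2)
    (S : Finset ℕ) (hS : S.card * (2 * n ^ 2 + 2) < m) (s : ℝ) (hs : 0 < s)
    (h1 : ∀ r ∈ S, n * t r * s ≤ 1 / 4) (h2 : ∀ r ∈ S, 1 / 4 ≤ m * (n * t r * s))
    (x : Fin n → ℝ) :
    ∃ y : Fin n → ℝ, (∀ i, x i ≤ y i) ∧ (∀ i, y i + s / m ≤ x i + s) ∧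
      ∀ r ∈ S, ∀ η : Fin n → ℝ, (∀ i, y i ≤ η i) → (∀ i, η i ≤ y i + s / m) →
        1 / (4 * m ^ 2 * n ^ 2) ≤ dnint (∑ i : Fin n, (u r i : ℝ) * η i) := by
  have hm0 : (0 : ℝ) < m := by positivity
  have hm2 : (2 : ℝ) ≤ m := by exact_mod_cast hm
  have hn1 : (1 : ℝ) ≤ n := by exact_mod_cast hn
  set c : ℝ := 1 / (4 * m ^ 2 * n ^ 2) with hc
  have hule : ∀ r i, |(u r i : ℝ)| ≤ t r := by
    intro r i
    refine abs_le_of_sq_le_sq ?_ (ht r).le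
    rw [hnorm r]
    exact Finset.single_le_sum (f := fun i => ((u r i : ℝ)) ^ 2)
      (fun _ _ => sq_nonneg _) (Finset.mem_univ i)
  have hbig : ∀ r, ∃ i, t r ≤ n * |(u r i : ℝ)| := by
    intro r
    by_contra hcon
    push Not at hcon
    have : ∑ i : Fin n, ((u r i : ℝ)) ^ 2 < ∑ i : Fin n, (t r) ^ 2 / n := by
      apply Finset.sum_lt_sum_of_nonempty
      · exact ⟨⟨0, hn⟩, Finset.mem_univ _⟩
      · intro i _
        have h := hcon i
        rw [lt_div_iff₀ (by positivity), ← sq_abs]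
        have ha := abs_nonneg (u r i : ℝ)
        calc |(u r i : ℝ)| ^ 2 * n ≤ (n * |(u r i : ℝ)|) ^ 2 := by
              rw [mul_pow, mul_comm]
              have : (n : ℝ) ≤ n ^ 2 := by nlinarith
              gcongr
          _ < t r ^ 2 := by gcongr
    rw [← hnorm r] at this
    simp only [Finset.sum_const, Finset.card_univ, Fintype.card_fin, nsmul_eq_mul] at this
    rw [mul_div_cancel₀ _ (by positivity)] at this
    exact lt_irrefl _ this
  let Y : (Fin n → Fin m) → Fin n → ℝ := fun p i => x i + s / m * ((p i : ℕ) : ℝ)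
  let w : ℕ → ℝ := fun r => c + n * t r * s / m
  obtain ⟨p, hp⟩ := aux_exists (n := n) (m := m) (L := 2 * n ^ 2 + 2) (by omega) S hS
    (fun r p => ∃ k : ℤ, |∑ i, (u r i : ℝ) * Y p i - k| < w r) (by
      intro r hr
      obtain ⟨i, hi⟩ := hbig r
      refine aux_count i _ ?_
      intro p
      have key : ∀ j : Fin m, ∑ l, (u r l : ℝ) * Y (Function.update p i j) l =
          (∑ l ∈ Finset.univ.erase i, (u r l : ℝ) * Y p l + (u r i : ℝ) * x i) +
            ((u r i : ℝ) * (s / m)) * ((j : ℕ) : ℝ) := by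
        intro j
        rw [← Finset.add_sum_erase _ _ (Finset.mem_univ i)]
        have : ∑ l ∈ Finset.univ.erase i, (u r l : ℝ) * Y (Function.update p i j) l =
            ∑ l ∈ Finset.univ.erase i, (u r l : ℝ) * Y p l := by
          apply Finset.sum_congr rfl
          intro l hl
          simp only [Y]
          rw [Function.update_of_ne (Finset.ne_of_mem_erase hl)]
        rw [this]
        simp only [Y, Function.update_self]
        ring
      simp only [key]
      have hb : |(u r i : ℝ) * (s / m)| = |(u r i : ℝ)| * (s / m) := by
        rw [abs_mul, abs_of_pos (by positivity : 0 < s / (m : ℝ))]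
      have htr := ht r
      have hA := h1 r hr
      have hB := h2 r hr
      apply aux_line
      · rw [hb, mul_assoc, div_mul_cancel₀ _ hm0.ne']
        calc |(u r i : ℝ)| * s ≤ t r * s := by gcongr; exact hule r i
          _ ≤ n * (t r * s) := le_mul_of_one_le_left (by positivity) hn1
          _ ≤ 1 / 4 := by linarith
      · have e1 : n * t r * s / m ≤ 1 / 8 := by
          rw [div_le_iff₀ hm0]; linarith
        have e2 : c ≤ 1 / 16 := by
          rw [hc]
          apply one_div_le_one_div_of_le (by norm_num)
          nlinarith [mul_le_mul hm2 hm2 (by norm_num) hm0.le, mul_le_mul hn1 hn1 (by norm_num) (by linarith),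
            mul_le_mul (by nlinarith : (4:ℝ) ≤ (m:ℝ)^2) (by nlinarith : (1:ℝ) ≤ (n:ℝ)^2) (by norm_num) (by positivity)]
        simp only [w]
        linarith
      · rw [hb]
        have e3 : c ≤ t r * s / (n * m) := by
          rw [hc, div_le_div_iff₀ (by positivity) (by positivity)]
          have : (n * m : ℝ) * (1 / 4) ≤ n * m * (m * (n * t r * s)) := by gcongr
          nlinarith
        have e4 : t r * s / (n * m) ≤ |(u r i : ℝ)| * (s / m) := by
          rw [div_le_iff₀ (by positivity)]
          have : |(u r i : ℝ)| * (s / m) * (n * m) = (n * |(u r i : ℝ)|) * s := by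
            field_simp
          rw [this]
          gcongr
        have e5 : n * t r * s / m = n ^ 2 * (t r * s / (n * m)) := by
          field_simp
        have e6 : (n : ℝ) ^ 2 * (t r * s / (n * m)) ≤ n ^ 2 * (|(u r i : ℝ)| * (s / m)) := by
          gcongr
        simp only [w]
        push_cast
        rw [e5]
        linarith)
  refine ⟨Y p, ?_, ?_, ?_⟩
  · intro i
    simp only [Y]
    have : 0 ≤ s / m * ((p i : ℕ) : ℝ) := by positivity
    linarith
  · intro i
    simp only [Y]
    have h : ((p i : ℕ) : ℝ) + 1 ≤ m := by exact_mod_cast (p i).2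
    have h' : s / m * (((p i : ℕ) : ℝ) + 1) ≤ s / m * m := by gcongr
    rw [div_mul_cancel₀ _ hm0.ne'] at h'
    linarith
  · intro r hr η hη1 hη2
    unfold dnint
    apply le_ciInf
    intro k
    have hk := hp r hr
    push Not at hk
    have hk := hk k
    have hd : |∑ i, (u r i : ℝ) * η i - ∑ i, (u r i : ℝ) * Y p i| ≤ n * t r * s / m := by
      rw [← Finset.sum_sub_distrib]
      calc _ ≤ ∑ i, |(u r i : ℝ) * η i - (u r i : ℝ) * Y p i| := Finset.abs_sum_le_sum_abs _ _
        _ ≤ ∑ i : Fin n, t r * (s / m) := by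
            apply Finset.sum_le_sum
            intro i _
            rw [← mul_sub, abs_mul]
            have := hη1 i
            have := hη2 i
            have h3 : |η i - Y p i| ≤ s / m := by rw [abs_le]; constructor <;> linarith
            exact mul_le_mul (hule r i) h3 (abs_nonneg _) (ht r).le
        _ = _ := by simp; ring
    simp only [w] at hk
    have h4 := abs_sub_le (∑ i, (u r i : ℝ) * Y p i) (∑ i, (u r i : ℝ) * η i) k
    rw [abs_sub_comm (∑ i, (u r i : ℝ) * Y p i) (∑ i, (u r i : ℝ) * η i)] at h4
    linarith

/-- For a lacunary sequence of integer vectors `u⁽ʳ⁾`, the set `N(Λ)` of `η`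
with `‖u⁽ʳ⁾ · η‖` uniformly bounded below is nonempty. -/
theorem lacunary_bad_set_nonempty (n : ℕ) (hn : 0 < n) (M : ℝ) (hM : 1 < M)
    (t : ℕ → ℝ) (ht : ∀ r, 0 < t r) (hlac : ∀ r, M ≤ t (r + 1) / t r)
    (u : ℕ → Fin n → ℤ) (hu : ∀ r, u r ≠ 0)
    (hnorm : ∀ r, (t r) ^ 2 = ∑ i : Fin n, ((u r i : ℝ)) ^ 2) :
    {η : Fin n → ℝ | ∃ c > (0 : ℝ),
        ∀ r : ℕ, c ≤ dnint (∑ i : Fin n, (u r i : ℝ) * η i)}.Nonempty := by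
  classical
  have hM0 : 0 < M := by linarith
  have hn0 : (0 : ℝ) < n := by exact_mod_cast hn
  have hgrow : ∀ r q, t r * M ^ q ≤ t (r + q) := by
    intro r q
    induction q with
    | zero => simp
    | succ q ih =>
      have := hlac (r + q)
      rw [le_div_iff₀ (ht _)] at this
      calc t r * M ^ (q + 1) = M * (t r * M ^ q) := by ring
        _ ≤ M * t (r + q) := by gcongr
        _ ≤ _ := this
  -- choice of the block length
  obtain ⟨N, hN1, hNM⟩ : ∃ N : ℕ, 1 ≤ N ∧
      ((N * (2 * n ^ 2 + 2) + 1 : ℕ) : ℝ) ≤ M ^ N := by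
    have hlim := tendsto_pow_const_div_const_pow_of_one_lt 1 hM
    have hpos : (0 : ℝ) < 1 / (2 * n ^ 2 + 3) := by positivity
    obtain ⟨N, h, hN⟩ := ((hlim.eventually_lt_const hpos).and
      (Filter.eventually_ge_atTop 1)).exists
    refine ⟨N, hN, ?_⟩
    rw [div_lt_div_iff₀ (by positivity) (by positivity)] at h
    have : (1 : ℝ) ≤ N := by exact_mod_cast hN
    push_cast
    nlinarith
  set m : ℕ := N * (2 * n ^ 2 + 2) + 1 with hm
  have hm2 : 2 ≤ m := by nlinarith [sq_nonneg n]
  have hm0 : (0 : ℝ) < m := by positivity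
  have hm1 : (1 : ℝ) < m := by exact_mod_cast hm2
  let s : ℕ → ℝ := fun k => 1 / (4 * n * t 0) / m ^ k
  have hs : ∀ k, 0 < s k := by intro k; have := ht 0; positivity
  have hs1 : ∀ k, s k / m = s (k + 1) := by
    intro k; simp only [s]; simp only [pow_succ, div_div, mul_assoc]
  have hns : ∀ k r, n * t r * s k = t r / (4 * t 0 * m ^ k) := by
    intro k r
    have := ht 0
    simp only [s]
    field_simp
  let P : ℕ → ℕ → Prop := fun k r => t r ≤ m ^ k * t 0 ∧ m ^ k * t 0 < m * t r
  have hwin : ∀ k a b, P k a → P k b → b < a + N := by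
    intro k a b ha hb
    by_contra hcon
    push Not at hcon
    obtain ⟨q, rfl⟩ := Nat.exists_eq_add_of_le hcon
    have h1 := hgrow a (N + q)
    rw [← add_assoc] at h1
    have h2 : (m : ℝ) ≤ M ^ (N + q) :=
      hNM.trans (pow_le_pow_right₀ hM.le (Nat.le_add_right _ _))
    have h3 : t a * m ≤ t a * M ^ (N + q) := mul_le_mul_of_nonneg_left h2 (ht a).le
    linarith [ha.2, hb.1]
  have hblock : ∀ k, ∃ S : Finset ℕ, S.card ≤ N ∧ ∀ r, r ∈ S ↔ P k r := by
    intro k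
    by_cases hne : ∃ r, P k r
    · obtain ⟨a, ha⟩ := hne
      let S := (Finset.range (a + N)).filter (P k)
      have hS : ∀ r, r ∈ S ↔ P k r := by
        intro r
        simp only [S, Finset.mem_filter, Finset.mem_range, and_iff_right_iff_imp]
        exact fun h => hwin k a r ha h
      refine ⟨S, aux_window S N ?_, hS⟩
      intro a ha b hb
      exact hwin k a b ((hS a).1 ha) ((hS b).1 hb)
    · push Not at hne
      exact ⟨∅, by simp, by simpa using hne⟩
  choose S hSc hSm using hblock
  have hstep := fun k x => aux_step hn hm2 t ht u hnorm (S k)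
    (lt_of_le_of_lt (Nat.mul_le_mul_right _ (hSc k)) (by omega)) (s k) (hs k)
    (by
      intro r hr
      have h := ((hSm k r).1 hr).1
      have := ht 0
      rw [hns, div_le_iff₀ (by positivity)]
      linarith)
    (by
      intro r hr
      have h := ((hSm k r).1 hr).2
      have := ht 0
      rw [hns, ← mul_div_assoc, le_div_iff₀ (by positivity)]
      linarith) x
  choose F hF1 hF2 hF3 using hstep
  let X : ℕ → Fin n → ℝ := fun k => Nat.rec 0 (fun k x => F k x) k
  have hX : ∀ k, X (k + 1) = F k (X k) := fun k => rfl
  let η : Fin n → ℝ := fun i => ⨆ k, X k i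
  have hη : ∀ i k, X k i ≤ η i ∧ η i ≤ X k i + s k := by
    intro i k
    have hmono : Monotone (fun k => X k i) :=
      monotone_nat_of_le_succ (fun k => by rw [hX]; exact hF1 k (X k) i)
    have hanti : Antitone (fun k => X k i + s k) :=
      antitone_nat_of_succ_le (fun k => by rw [hX, ← hs1]; exact hF2 k (X k) i)
    have := hmono.ciSup_mem_iInter_Icc_of_antitone hanti
      (fun k => by have := hs k; simp only; linarith)
    exact Set.mem_iInter.1 this k
  have hc : (0 : ℝ) < 1 / (4 * m ^ 2 * n ^ 2) := by positivity
  refine ⟨η, _, hc, ?_⟩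
  intro r
  have hex : ∃ k, P k r := by
    have hge : t 0 ≤ t r := by
      have := hgrow 0 r
      rw [zero_add] at this
      exact (le_mul_of_one_le_right (ht 0).le (one_le_pow₀ hM.le)).trans this
    have hE : ∃ k : ℕ, t r ≤ m ^ k * t 0 := by
      obtain ⟨k, hk⟩ := pow_unbounded_of_one_lt (t r / t 0) hm1
      rw [div_lt_iff₀ (ht 0)] at hk
      exact ⟨k, hk.le⟩
    refine ⟨Nat.find hE, Nat.find_spec hE, ?_⟩
    rcases hk : Nat.find hE with _ | k
    · have := ht r
      rw [pow_zero, one_mul]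
      nlinarith
    · have := Nat.find_min hE (m := k) (by omega)
      push Not at this
      rw [pow_succ]
      nlinarith
  obtain ⟨k, hk⟩ := hex
  refine hF3 k (X k) r ((hSm k r).2 hk) η (fun i => ?_) (fun i => ?_)
  · rw [← hX]; exact (hη i (k + 1)).1
  · rw [← hX, hs1]; exact (hη i (k + 1)).2
end

section
/- Let n be a positive integer, M > 1 a real number, and let (t_r)_{r≥1} be a sequence of positive reals satisfying the lacunarity condition t_{r+1}/t_r ≥ M for all r ≥ 1. Let (u^{(r)})_{r≥1} be a sequence of nonzero integer vectors u^{(r)} = (u_1^{(r)}, …, u_n^{(r)}) ∈ ℤ^n with t_r² = (u_1^{(r)})² + ⋯ + (u_n^{(r)})² for all r. Then the set N(Λ) = {η = (η_1,…,η_n) ∈ ℝ^n : there exists c(η) > 0 such that ‖u_1^{(r)} η_1 + ⋯ + u_n^{(r)} η_n‖ ≥ c(η) for all r ∈ ℕ} has full Hausdorff dimension in ℝ^n, i.e. its Hausdorff dimension equals n. -/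
open Set in
lemma tree_dim (n m K : ℕ) (hm : 0 < m) (hK : 1 < K) (δ : ℝ) (hδ : 0 < δ) (s : NNReal)
    (hs : 0 < s) (hRK : (2 * m : ℝ) ^ (s : ℝ) ≤ K) (ρ : ℕ → ℝ)
    (hρ : ∀ k, ρ k = δ * ((2 * m : ℝ) ^ k)⁻¹)
    (e : ℕ → (Fin n → ℝ) → Fin K → (Fin n → Fin m))
    (he : ∀ k x, Function.Injective (e k x)) (S : Set (Fin n → ℝ))
    (hS : ∀ η : Fin n → ℝ, (∀ k, ∃ x d, ∀ i, x i + (e k x d i : ℕ) * ρ k ≤ η i ∧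
      η i ≤ x i + (e k x d i : ℕ) * ρ k + ρ k) → η ∈ S) : (s : ENNReal) ≤ dimH S := by
  have hm' : (1 : ℝ) ≤ m := by exact_mod_cast hm
  have hρpos : ∀ k, 0 < ρ k := fun k => by rw [hρ]; positivity
  have hρs : ∀ k, m * ρ (k + 1) = ρ k / 2 := fun k => by
    rw [hρ, hρ, pow_succ]; field_simp
  let X : (ℕ → Fin K) → ℕ → (Fin n → ℝ) := fun ω k =>
    Nat.rec (fun _ => (0 : ℝ)) (fun k x => fun i => x i + (e k x (ω k) i : ℕ) * ρ k) k
  have hX : ∀ ω k i, X ω (k + 1) i = X ω k i + (e k (X ω k) (ω k) i : ℕ) * ρ k :=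
    fun ω k i => rfl
  have hmono : ∀ ω i, Monotone (fun k => X ω k i) := fun ω i => monotone_nat_of_le_succ fun k => by
    rw [hX]; have := hρpos k
    have : 0 ≤ ((e k (X ω k) (ω k) i : ℕ) : ℝ) * ρ k := by positivity
    linarith
  have hdig : ∀ k x d i, ((e k x d i : ℕ) : ℝ) ≤ m - 1 := fun k x d i => by
    have : ((e k x d i : ℕ) : ℝ) + 1 ≤ m := by exact_mod_cast (e k x d i).2
    linarith
  have hanti : ∀ ω i, Antitone (fun k => X ω k i + m * ρ k) :=
    fun ω i => antitone_nat_of_succ_le fun k => by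
      rw [hX, hρs]
      have h1 := hρpos k
      have := mul_le_mul_of_nonneg_right (hdig k (X ω k) (ω k) i) h1.le
      linarith
  let x : (ℕ → Fin K) → (Fin n → ℝ) := fun ω i => ⨆ k, X ω k i
  have hx : ∀ ω k i, X ω k i ≤ x ω i ∧ x ω i ≤ X ω k i + m * ρ k := fun ω k i => by
    have := (hmono ω i).ciSup_mem_iInter_Icc_of_antitone (hanti ω i)
      (fun k => by have := hρpos k; have : 0 ≤ m * ρ k := by positivity
                   simp only; linarith)
    rw [mem_iInter] at this
    exact this k
  have hx' : ∀ ω k i, X ω k i + (e k (X ω k) (ω k) i : ℕ) * ρ k ≤ x ω i ∧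
      x ω i ≤ X ω k i + (e k (X ω k) (ω k) i : ℕ) * ρ k + ρ k / 2 := fun ω k i => by
    have := hx ω (k + 1) i
    rwa [hX, hρs] at this
  have hagree : ∀ ω ω' k, (∀ j < k, ω j = ω' j) → X ω k = X ω' k := by
    intro ω ω' k
    induction k with
    | zero => intro _; rfl
    | succ k ih =>
      intro h
      funext i
      rw [hX, hX, ih (fun j hj => h j (by omega)), h k (by omega)]
  have hsep : ∀ ω ω' k, (∀ j < k, ω j = ω' j) → ω k ≠ ω' k → ρ k / 2 ≤ dist (x ω) (x ω') := by
    intro ω ω' k h hne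
    have hXX := hagree ω ω' k h
    have h1 : e k (X ω k) (ω k) ≠ e k (X ω k) (ω' k) := fun hh => hne (he _ _ hh)
    obtain ⟨i, hi⟩ := Function.ne_iff.mp h1
    have h2 := hx' ω k i
    have h3 := hx' ω' k i
    rw [← hXX] at h3
    refine le_trans ?_ (dist_le_pi_dist _ _ i)
    rw [Real.dist_eq, le_abs]
    have hp := hρpos k
    generalize e k (X ω k) (ω k) i = a at *
    generalize e k (X ω k) (ω' k) i = b at *
    rcases lt_or_gt_of_ne hi with h | h
    · right
      have : ((a : ℕ) : ℝ) + 1 ≤ (b : ℕ) := by exact_mod_cast h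
      nlinarith
    · left
      have : ((b : ℕ) : ℝ) + 1 ≤ (a : ℕ) := by exact_mod_cast h
      nlinarith
  have hfirst : ∀ ω ω' : ℕ → Fin K, ω ≠ ω' → ∃ k, (∀ j < k, ω j = ω' j) ∧ ω k ≠ ω' k := by
    intro ω ω' hne
    have h := Function.ne_iff.mp hne
    classical
    exact ⟨Nat.find h, fun j hj => not_not.mp (Nat.find_min h hj), Nat.find_spec h⟩
  have hinj : Function.Injective x := by
    intro ω ω' h
    by_contra hne
    obtain ⟨k, h1, h2⟩ := hfirst ω ω' hne
    have := hsep ω ω' k h1 h2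
    rw [h, dist_self] at this
    linarith [hρpos k]
  have : NeZero K := ⟨by omega⟩
  let f : (Fin n → ℝ) → ℝ := fun y => Real.ofDigits (Function.invFun x y)
  have hf : ∀ ω, f (x ω) = Real.ofDigits ω := fun ω => by
    simp only [f, Function.leftInverse_invFun hinj ω]
  have hHol : HolderOnWith ((2 / δ) ^ (s : ℝ)).toNNReal s f (range x) := by
    rintro _ ⟨ω, rfl⟩ _ ⟨ω', rfl⟩
    by_cases hne : ω = ω'
    · subst hne; simp
    obtain ⟨k, h1, h2⟩ := hfirst ω ω' hne
    have h3 := hsep ω ω' k h1 h2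
    have h4 := Real.abs_ofDigits_sub_ofDigits_le h1
    rw [hf, hf, edist_dist, edist_dist,
      ENNReal.ofReal_rpow_of_nonneg dist_nonneg (NNReal.coe_nonneg s)]
    change _ ≤ ENNReal.ofReal _ * _
    rw [← ENNReal.ofReal_mul (by positivity)]
    apply ENNReal.ofReal_le_ofReal
    rw [Real.dist_eq]
    refine h4.trans ?_
    rw [← Real.mul_rpow (by positivity) dist_nonneg]
    have h5 : ((2 * m : ℝ) ^ k)⁻¹ ≤ 2 / δ * dist (x ω) (x ω') := by
      rw [hρ] at h3
      calc ((2 * m : ℝ) ^ k)⁻¹ = 2 / δ * (δ * ((2 * m : ℝ) ^ k)⁻¹ / 2) := by field_simp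
        _ ≤ _ := by gcongr
    refine le_trans ?_ (Real.rpow_le_rpow (by positivity) h5 s.2)
    have h6 : ((2 * m : ℝ) ^ k) ^ (s : ℝ) = ((2 * m : ℝ) ^ (s : ℝ)) ^ k := by
      rw [← Real.rpow_natCast, ← Real.rpow_mul (by positivity),
        mul_comm (k : ℝ), Real.rpow_mul (by positivity), Real.rpow_natCast]
    rw [Real.inv_rpow (by positivity), h6]
    gcongr
  have hdim := hHol.dimH_image_le hs
  have himg : Icc (0 : ℝ) 1 ⊆ f '' range x := by
    intro y hy
    obtain ⟨ω, -, hω⟩ := Real.ofDigits_SurjOn hK hy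
    exact ⟨x ω, ⟨ω, rfl⟩, by rw [hf, hω]⟩
  have h1 : dimH (Icc (0 : ℝ) 1) = 1 := by
    rw [Real.dimH_of_nonempty_interior (by simp)]; simp
  have h2 : (1 : ENNReal) ≤ dimH (range x) / s := by
    rw [← h1]; exact (dimH_mono himg).trans hdim
  have hs0 : (s : ENNReal) ≠ 0 := by exact_mod_cast hs.ne'
  rw [ENNReal.le_div_iff_mul_le (Or.inl hs0) (Or.inl ENNReal.coe_ne_top), one_mul] at h2
  refine h2.trans (dimH_mono ?_)
  rintro _ ⟨ω, rfl⟩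
  refine hS _ fun k => ⟨X ω k, ω k, fun i => ?_⟩
  have := hx' ω k i
  exact ⟨this.1, by linarith [hρpos k]⟩

lemma count_bad (n m D : ℕ) (i : Fin n) (bad : Finset (Fin n → Fin m))
    (h : ∀ v ∈ bad, ∀ w ∈ bad, (∀ j, j ≠ i → v j = w j) → (v i : ℕ) ≤ (w i : ℕ) + D) :
    bad.card ≤ (D + 1) * m ^ (n - 1) := by
  classical
  let g : (Fin n → Fin m) → ({j // j ≠ i} → Fin m) × Fin (D + 1) :=
    fun v => (fun j => v j, ⟨(v i : ℕ) % (D + 1), Nat.mod_lt _ (by omega)⟩)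
  have := Finset.card_le_card_of_injOn (s := bad) (t := Finset.univ) g (by simp) (by
    intro v hv w hw hvw
    simp only [g, Prod.mk.injEq, Fin.mk.injEq] at hvw
    have h1 : ∀ j, j ≠ i → v j = w j := fun j hj => congrFun hvw.1 ⟨j, hj⟩
    have h2 := h v hv w hw h1
    have h3 := h w hw v hv (fun j hj => (h1 j hj).symm)
    have h4 : (v i : ℕ) = w i := by
      rcases le_total (v i : ℕ) (w i) with hl | hl
      · have h5 := (Nat.modEq_iff_dvd' hl).mp hvw.2
        by_contra hne
        have := Nat.le_of_dvd (by omega) h5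
        omega
      · have h5 := (Nat.modEq_iff_dvd' hl).mp hvw.2.symm
        by_contra hne
        have := Nat.le_of_dvd (by omega) h5
        omega
    funext j
    by_cases hj : j = i
    · subst hj; exact Fin.ext h4
    · exact h1 j hj)
  refine this.trans (le_of_eq ?_)
  simp [Fintype.card_subtype_compl, mul_comm]

def IsBad {n m : ℕ} (u : Fin n → ℤ) (x : Fin n → ℝ) (ρ c : ℝ) (v : Fin n → Fin m) : Prop :=
  ∃ η : Fin n → ℝ, (∀ i, x i + (v i : ℕ) * ρ ≤ η i ∧ η i ≤ x i + (v i : ℕ) * ρ + ρ) ∧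
    ∃ p : ℤ, |∑ i, (u i : ℝ) * η i - p| < c

open Classical in
lemma bad_card (n m : ℕ) (hn : 0 < n) (hm : 0 < m) (u : Fin n → ℤ) (t : ℝ) (ht : 0 < t)
    (hu : t ^ 2 = ∑ i, (u i : ℝ) ^ 2) (x : Fin n → ℝ) (ρ c : ℝ) (hρ : 0 < ρ)
    (h1 : n * m * ρ * t ≤ 1 / 4) (h2 : 2 * c ≤ t * ρ) :
    (Finset.univ.filter (fun v : Fin n → Fin m => IsBad u x ρ c v)).card
      ≤ (n ^ 2 + n + 1) * m ^ (n - 1) := by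
  have : Nonempty (Fin n) := ⟨⟨0, hn⟩⟩
  obtain ⟨i, hi⟩ := Finite.exists_max (fun i => |(u i : ℝ)|)
  have hn1 : (1 : ℝ) ≤ n := by exact_mod_cast hn
  have hm1 : (1 : ℝ) ≤ m := by exact_mod_cast hm
  have hut : ∀ j, |(u j : ℝ)| ≤ t := fun j => by
    refine abs_le_of_sq_le_sq ?_ ht.le
    rw [hu]
    exact Finset.single_le_sum (f := fun i => (u i : ℝ) ^ 2) (fun _ _ => sq_nonneg _)
      (Finset.mem_univ j)
  have htu : t ≤ n * |(u i : ℝ)| := by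
    refine (sq_le_sq₀ ht.le (by positivity)).mp ?_
    rw [hu]
    calc ∑ j, (u j : ℝ) ^ 2 ≤ ∑ j : Fin n, |(u i : ℝ)| ^ 2 := by
          apply Finset.sum_le_sum; intro j _
          rw [← sq_abs]; have := hi j; gcongr
      _ = n * |(u i : ℝ)| ^ 2 := by simp
      _ ≤ (n * |(u i : ℝ)|) ^ 2 := by
          rw [mul_pow]; gcongr; nlinarith
  have hui : 0 < |(u i : ℝ)| := by
    by_contra h
    have : |(u i : ℝ)| = 0 := le_antisymm (not_lt.mp h) (abs_nonneg _)
    rw [this] at htu; linarith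
  apply count_bad n m _ i
  intro v hv w hw hvw
  simp only [Finset.mem_filter, Finset.mem_univ, true_and] at hv hw
  obtain ⟨η, hη, p, hp⟩ := hv
  obtain ⟨ξ, hξ, q, hq⟩ := hw
  have hvi : ((v i : ℕ) : ℝ) + 1 ≤ m := by exact_mod_cast (v i).2
  have hwi : ((w i : ℕ) : ℝ) + 1 ≤ m := by exact_mod_cast (w i).2
  have hv0 : (0 : ℝ) ≤ ((v i : ℕ) : ℝ) := by positivity
  have hw0 : (0 : ℝ) ≤ ((w i : ℕ) : ℝ) := by positivity
  have hsum : ∀ (z : Fin n → ℝ) (B : ℝ), 0 ≤ B → (∀ j, |z j| ≤ B) →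
      |∑ j, (u j : ℝ) * z j| ≤ n * (t * B) := by
    intro z B hB hz
    calc |∑ j, (u j : ℝ) * z j| ≤ ∑ j, |(u j : ℝ) * z j| := Finset.abs_sum_le_sum_abs _ _
      _ ≤ ∑ j : Fin n, t * B := by
          apply Finset.sum_le_sum; intro j _
          rw [abs_mul]; exact mul_le_mul (hut j) (hz j) (abs_nonneg _) ht.le
      _ = _ := by simp
  have hd : ∑ j, (u j : ℝ) * (η j - ξ j) = ∑ j, (u j : ℝ) * η j - ∑ j, (u j : ℝ) * ξ j := by
    rw [← Finset.sum_sub_distrib]; simp_rw [mul_sub]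
  have hA : |∑ j, (u j : ℝ) * (η j - ξ j)| ≤ n * (t * (m * ρ)) := by
    apply hsum _ _ (by positivity)
    intro j
    have a := hη j
    have b := hξ j
    by_cases hj : j = i
    · subst hj
      rw [abs_le]; constructor <;> nlinarith
    · rw [hvw j hj] at a
      rw [abs_le]; constructor <;> nlinarith
  have htρ : t * ρ ≤ 1 / 4 := by
    refine le_trans ?_ h1
    have : 1 ≤ (n : ℝ) * m := by nlinarith
    have := mul_le_mul_of_nonneg_right this (by positivity : 0 ≤ t * ρ)
    linarith
  rw [abs_lt] at hp hq
  have hpq : p = q := by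
    have h3 : |((p - q : ℤ) : ℝ)| < 1 := by
      rw [hd, abs_le] at hA
      rw [abs_lt]; push_cast; constructor <;> linarith
    have h4 : |p - q| < 1 := by exact_mod_cast h3
    have := Int.abs_lt_one_iff.mp h4
    omega
  subst hpq
  have hB : |∑ j, (u j : ℝ) * (η j - ξ j - ((v j : ℕ) - (w j : ℕ)) * ρ)| ≤ n * (t * ρ) := by
    apply hsum _ _ hρ.le
    intro j
    have a := hη j
    have b := hξ j
    rw [abs_le]; constructor <;> linarith
  have hC : ∑ j, (u j : ℝ) * (η j - ξ j - ((v j : ℕ) - (w j : ℕ)) * ρ)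
      = ∑ j, (u j : ℝ) * (η j - ξ j) - u i * (((v i : ℕ) - (w i : ℕ)) * ρ) := by
    rw [eq_sub_iff_add_eq, ← eq_sub_iff_add_eq', ← Finset.sum_sub_distrib]
    symm
    rw [Finset.sum_eq_single i]
    · ring
    · intro j _ hj; rw [hvw j hj]; ring
    · simp
  rw [hC, hd] at hB
  have hE : |(u i : ℝ) * (((v i : ℕ) - (w i : ℕ)) * ρ)| ≤ n * (t * ρ) + t * ρ := by
    rw [abs_le] at hB ⊢
    constructor <;> linarith
  rw [abs_mul, abs_mul, abs_of_pos hρ] at hE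
  have hF : |(u i : ℝ)| * ρ * |((v i : ℕ) : ℝ) - (w i : ℕ)| ≤
      |(u i : ℝ)| * ρ * (n ^ 2 + n) := by
    have : (n + 1) * ρ * t ≤ (n + 1) * ρ * (n * |(u i : ℝ)|) := by gcongr
    linarith
  have hG := le_of_mul_le_mul_left hF (by positivity)
  have hH := (le_abs_self _).trans hG
  have : ((v i : ℕ) : ℝ) ≤ ((w i : ℕ) : ℝ) + ((n ^ 2 + n : ℕ) : ℝ) := by push_cast; linarith
  exact_mod_cast this

lemma block_bound (M : ℝ) (hM : 1 < M) (t : ℕ → ℝ) (ht : ∀ r, 0 < t r)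
    (hlac : ∀ r, M ≤ t (r + 1) / t r) (R : ℝ) (hR : 0 < R) (L : ℕ) (hL : R ≤ M ^ L) (k : ℕ) :
    ∃ r0, ∀ r, R ^ k ≤ t r → t r < R ^ (k + 1) → r ∈ Finset.Ico r0 (r0 + L) := by
  classical
  have hstep : ∀ r a, M ^ a * t r ≤ t (r + a) := by
    intro r a
    induction a with
    | zero => simp
    | succ a ih =>
      have h1 := hlac (r + a)
      rw [le_div_iff₀ (ht _)] at h1
      rw [← add_assoc, pow_succ']
      refine le_trans ?_ h1
      rw [mul_assoc]
      gcongr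
  by_cases hex : ∃ r, R ^ k ≤ t r ∧ t r < R ^ (k + 1)
  · refine ⟨Nat.find hex, fun r h1 h2 => ?_⟩
    have hs := Nat.find_spec hex
    have hmin := Nat.find_min' hex ⟨h1, h2⟩
    rw [Finset.mem_Ico]
    refine ⟨hmin, ?_⟩
    by_contra hcon
    push Not at hcon
    generalize Nat.find hex = r0 at *
    obtain ⟨b, rfl⟩ := Nat.exists_eq_add_of_le hcon
    have h3 := hstep r0 (L + b)
    rw [← add_assoc] at h3
    have h4 : M ^ L ≤ M ^ (L + b) := pow_le_pow_right₀ hM.le (by omega)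
    have h5 : R * t r0 ≤ t (r0 + L + b) :=
      (mul_le_mul_of_nonneg_right (hL.trans h4) (ht r0).le).trans h3
    have h6 : R ^ (k + 1) ≤ R * t r0 := by
      rw [pow_succ']; exact mul_le_mul_of_nonneg_left hs.1 hR.le
    linarith
  · push Not at hex
    exact ⟨0, fun r h1 h2 => absurd h2 (not_lt.mpr (hex r h1))⟩

lemma exists_param (n D : ℕ) (hD : 0 < D) (M : ℝ) (hM : 1 < M) (s : ℝ) (hs0 : 0 < s)
    (hs : s < n) : ∃ L : ℕ, 0 < L ∧ (4 * (D * L) : ℝ) ≤ M ^ L ∧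
      (4 * (D * L) : ℝ) ^ s ≤ (D * L) * (2 * (D * L)) ^ (n - 1) := by
  have hn : 0 < n := by
    have : (0 : ℝ) < n := hs0.trans hs
    exact_mod_cast this
  have e1 : ∀ᶠ L : ℕ in Filter.atTop, (4 * (D * L) : ℝ) ≤ M ^ L := by
    have h := tendsto_pow_const_div_const_pow_of_one_lt 1 hM
    have hD' : (0 : ℝ) < 1 / (4 * D) := by positivity
    filter_upwards [h.eventually (gt_mem_nhds hD')] with L hL
    have hMp : 0 < M ^ L := by positivity
    rw [div_lt_div_iff₀ hMp (by positivity)] at hL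
    rw [pow_one] at hL
    linarith
  have e2 : ∀ᶠ L : ℕ in Filter.atTop, (4 : ℝ) ^ n ≤ (L : ℝ) ^ (n - s) :=
    ((tendsto_rpow_atTop (sub_pos.mpr hs)).comp
      tendsto_natCast_atTop_atTop).eventually_ge_atTop _
  obtain ⟨L, hL0, h1, h2⟩ := ((Filter.eventually_gt_atTop 0).and (e1.and e2)).exists
  refine ⟨L, hL0, h1, ?_⟩
  have hL1 : (1 : ℝ) ≤ L := by exact_mod_cast hL0
  have hD1 : (1 : ℝ) ≤ D := by exact_mod_cast hD
  have hq : (L : ℝ) ≤ D * L := by nlinarith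
  have h2' : (4 : ℝ) ^ n ≤ (D * L : ℝ) ^ (n - s) :=
    h2.trans (Real.rpow_le_rpow (by positivity) hq (by linarith))
  generalize (D * L : ℝ) = q at *
  have hq1 : 1 ≤ q := hL1.trans hq
  have hq0 : 0 < q := by linarith
  calc (4 * q) ^ s = 4 ^ s * q ^ s := Real.mul_rpow (by norm_num) hq0.le
    _ ≤ 4 ^ (n : ℝ) * q ^ s := by
        gcongr
        norm_num
    _ = 4 ^ n * q ^ s := by rw [Real.rpow_natCast]
    _ ≤ q ^ (n - s) * q ^ s := by gcongr
    _ = q ^ n := by rw [← Real.rpow_add hq0]; simp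
    _ = q * q ^ (n - 1) := by rw [← pow_succ']; congr 1; omega
    _ ≤ q * (2 * q) ^ (n - 1) := by
        gcongr
        linarith

/-- For a lacunary sequence of integer vectors `u⁽ʳ⁾`, the set `N(Λ)` of `η`
with `‖u⁽ʳ⁾ · η‖` uniformly bounded below has full Hausdorff dimension `n`. -/
theorem lacunary_bad_set_full_dimension (n : ℕ) (hn : 0 < n) (M : ℝ) (hM : 1 < M)
    (t : ℕ → ℝ) (ht : ∀ r, 0 < t r) (hlac : ∀ r, M ≤ t (r + 1) / t r)
    (u : ℕ → Fin n → ℤ) (hu : ∀ r, u r ≠ 0)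
    (hnorm : ∀ r, (t r) ^ 2 = ∑ i : Fin n, ((u r i : ℝ)) ^ 2) :
    dimH {η : Fin n → ℝ | ∃ c > (0 : ℝ),
        ∀ r : ℕ, c ≤ dnint (∑ i : Fin n, (u r i : ℝ) * η i)} = (n : ℕ) := by
  classical
  apply le_antisymm
  · exact (dimH_mono (Set.subset_univ _)).trans (Real.dimH_univ_pi_fin n).le
  apply ENNReal.le_of_forall_nnreal_lt
  intro s hs
  rcases eq_or_lt_of_le (zero_le : 0 ≤ s) with h0 | h0
  · rw [← h0]; simp
  have hs' : (s : ℝ) < n := by exact_mod_cast hs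
  obtain ⟨L, hL0, hL1, hL2⟩ := exists_param n (n ^ 2 + n + 1) (by positivity) M hM s
    (by exact_mod_cast h0) hs'
  obtain ⟨q, hq⟩ : ∃ q, q = (n ^ 2 + n + 1) * L := ⟨_, rfl⟩
  have hq' : (((n ^ 2 + n + 1 : ℕ) : ℝ) * L) = q := by rw [hq]; push_cast; ring
  rw [hq'] at hL1 hL2
  have hq0 : 0 < q := by rw [hq]; positivity
  obtain ⟨m, hm⟩ : ∃ m, m = 2 * q := ⟨_, rfl⟩
  have hm0 : 0 < m := by omega
  have hmR : (2 * m : ℝ) = 4 * q := by rw [hm]; push_cast; ring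
  have hm1 : (1 : ℝ) ≤ m := by exact_mod_cast hm0
  have hn1 : (1 : ℝ) ≤ n := by exact_mod_cast hn
  obtain ⟨K, hK⟩ : ∃ K, K = q * m ^ (n - 1) := ⟨_, rfl⟩
  have hRK : (2 * m : ℝ) ^ (s : ℝ) ≤ K := by
    rw [hmR, hK, hm]; push_cast; exact hL2
  have hK1 : 1 < K := by
    have : (1 : ℝ) < K := (Real.one_lt_rpow (by linarith) (by exact_mod_cast h0)).trans_le hRK
    exact_mod_cast this
  have hKm : m ^ n = 2 * K := by
    rw [hK, ← mul_assoc, ← hm, ← pow_succ']; congr 1; omega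
  obtain ⟨δ, hδ⟩ : ∃ δ : ℝ, δ = 1 / (4 * n * m * (2 * m)) := ⟨_, rfl⟩
  have hδ0 : 0 < δ := by rw [hδ]; positivity
  let ρ : ℕ → ℝ := fun k => δ * ((2 * m : ℝ) ^ k)⁻¹
  have hρ0 : ∀ k, 0 < ρ k := fun k => by positivity
  have hbad : ∀ k r, (2 * m : ℝ) ^ k ≤ t r → t r < (2 * m : ℝ) ^ (k + 1) → ∀ x : Fin n → ℝ,
      (Finset.univ.filter (fun v : Fin n → Fin m => IsBad (u r) x (ρ k) (δ / 2) v)).card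
      ≤ (n ^ 2 + n + 1) * m ^ (n - 1) := by
    intro k r h1 h2 x
    apply bad_card n m hn hm0 (u r) (t r) (ht r) (hnorm r) x _ _ (hρ0 k)
    · calc n * m * ρ k * t r ≤ n * m * ρ k * (2 * m : ℝ) ^ (k + 1) := by
            have := hρ0 k; gcongr
        _ = 1 / 4 := by simp only [ρ, hδ]; rw [pow_succ]; field_simp
    · calc 2 * (δ / 2) = (2 * m : ℝ) ^ k * ρ k := by simp only [ρ]; field_simp
        _ ≤ t r * ρ k := by have := hρ0 k; gcongr
  let Good : ℕ → (Fin n → ℝ) → Finset (Fin n → Fin m) := fun k x =>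
    Finset.univ.filter (fun v => ∀ r, (2 * m : ℝ) ^ k ≤ t r → t r < (2 * m : ℝ) ^ (k + 1) →
      ¬ IsBad (u r) x (ρ k) (δ / 2) v)
  have hGood : ∀ k x, K ≤ (Good k x).card := by
    intro k x
    obtain ⟨r0, hr0⟩ := block_bound M hM t ht hlac (2 * m) (by positivity) L
      (by rw [hmR]; exact hL1) k
    let I := (Finset.Ico r0 (r0 + L)).filter
      (fun r => (2 * m : ℝ) ^ k ≤ t r ∧ t r < (2 * m : ℝ) ^ (k + 1))
    have hsub : (Finset.univ : Finset (Fin n → Fin m)) ⊆ Good k x ∪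
        I.biUnion (fun r => Finset.univ.filter
          (fun v : Fin n → Fin m => IsBad (u r) x (ρ k) (δ / 2) v)) := by
      intro v _
      by_cases hv : v ∈ Good k x
      · exact Finset.mem_union_left _ hv
      · apply Finset.mem_union_right
        simp only [Good, Finset.mem_filter, Finset.mem_univ, true_and] at hv
        push Not at hv
        obtain ⟨r, h1, h2, h3⟩ := hv
        simp only [Finset.mem_biUnion, Finset.mem_filter, Finset.mem_univ, true_and]
        exact ⟨r, Finset.mem_filter.mpr ⟨hr0 r h1 h2, h1, h2⟩, h3⟩
    have c1 := (Finset.card_le_card hsub).trans (Finset.card_union_le _ _)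
    have c2 : (I.biUnion (fun r => Finset.univ.filter
          (fun v : Fin n → Fin m => IsBad (u r) x (ρ k) (δ / 2) v))).card ≤
          I.card * ((n ^ 2 + n + 1) * m ^ (n - 1)) := by
      apply Finset.card_biUnion_le_card_mul
      intro r hr
      have := (Finset.mem_filter.mp hr).2
      exact hbad k r this.1 this.2 x
    have c3 : I.card ≤ L := (Finset.card_filter_le _ _).trans (by simp)
    have c4 : I.card * ((n ^ 2 + n + 1) * m ^ (n - 1)) ≤ K := by
      calc _ ≤ L * ((n ^ 2 + n + 1) * m ^ (n - 1)) := Nat.mul_le_mul_right _ c3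
        _ = K := by rw [hK, hq]; ring
    have c5 : (Finset.univ : Finset (Fin n → Fin m)).card = 2 * K := by
      rw [← hKm]; simp
    omega
  have hemb : ∀ k x, Nonempty (Fin K ↪ Good k x) := fun k x =>
    Function.Embedding.nonempty_of_card_le (by simpa using hGood k x)
  let e : ℕ → (Fin n → ℝ) → Fin K → (Fin n → Fin m) := fun k x d =>
    ((hemb k x).some d : Fin n → Fin m)
  have heG : ∀ k x d, e k x d ∈ Good k x := fun k x d => ((hemb k x).some d).2
  refine tree_dim n m K hm0 hK1 δ hδ0 s h0 hRK ρ (fun _ => rfl) e ?_ _ ?_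
  · intro k x d d' h
    exact (hemb k x).some.injective (Subtype.ext h)
  intro η hη
  refine ⟨δ / 2, by positivity, fun r => ?_⟩
  have ht1 : 1 ≤ t r := by
    obtain ⟨i, hi⟩ := Function.ne_iff.mp (hu r)
    have h1 : (1 : ℤ) ≤ (u r i) ^ 2 := by
      have : 0 < (u r i) ^ 2 := by
        have : u r i ≠ 0 := hi
        positivity
      omega
    have h2 : (1 : ℝ) ≤ (u r i : ℝ) ^ 2 := by exact_mod_cast h1
    have h3 : (u r i : ℝ) ^ 2 ≤ t r ^ 2 := by
      rw [hnorm]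
      exact Finset.single_le_sum (f := fun i => (u r i : ℝ) ^ 2) (fun _ _ => sq_nonneg _)
        (Finset.mem_univ i)
    have := ht r
    nlinarith
  obtain ⟨k, hk1, hk2⟩ := exists_nat_pow_near ht1 (by linarith : (1 : ℝ) < 2 * m)
  obtain ⟨x, d, hxd⟩ := hη k
  have hg := (Finset.mem_filter.mp (heG k x d)).2 r hk1 hk2
  unfold dnint
  apply le_ciInf
  intro p
  by_contra hcon
  exact hg ⟨η, hxd, p, not_le.mp hcon⟩
end

section
/- Let n be a positive integer, M > 1 a real number, and let (t_r)_{r≥1} be a sequence of positive reals satisfying the lacunarity condition t_{r+1}/t_r ≥ M for all r ≥ 1. Let (u^{(r)})_{r≥1} be a sequence of nonzero integer vectors u^{(r)} = (u_1^{(r)}, …, u_n^{(r)}) ∈ ℤ^n with t_r² = (u_1^{(r)})² + ⋯ + (u_n^{(r)})² for all r. Then the set N(Λ) = {η = (η_1,…,η_n) ∈ ℝ^n : there exists c(η) > 0 such that ‖u_1^{(r)} η_1 + ⋯ + u_n^{(r)} η_n‖ ≥ c(η) for all r ∈ ℕ} is dense in ℝ^n. -/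
/-- One step of the construction: avoid finitely many families of slabs at once. -/
theorem lac_step (n : ℕ) (hn : 0 < n) (t : ℕ → ℝ) (ht : ∀ r, 0 < t r) (u : ℕ → Fin n → ℤ)
    (hnorm : ∀ r, (t r) ^ 2 = ∑ i : Fin n, ((u r i : ℝ)) ^ 2)
    (S : Finset ℕ) (J : ℕ) (hJ : S.card < J) (h : ℝ) (hh : 0 < h)
    (hS : ∀ r ∈ S, t r * h * (J + 1) < 1) (x : Fin n → ℝ) :
    ∃ y : Fin n → ℝ, (∀ i, |y i - x i| ≤ J * h) ∧
      ∀ r ∈ S, ∀ k : ℤ, t r * h / (2 * n) ≤ |∑ i, (u r i : ℝ) * y i - k| := by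
  classical
  have hn' : (1 : ℝ) ≤ n := by exact_mod_cast hn
  have hn0 : (0 : ℝ) < n := by linarith
  let y : (Fin n → Fin J) → Fin n → ℝ := fun j i => x i + h * ((j i : ℕ) : ℝ)
  let Bad : ℕ → Finset (Fin n → Fin J) := fun r =>
    Finset.univ.filter (fun j => ∃ k : ℤ, |∑ i, (u r i : ℝ) * y j i - k| < t r * h / (2 * n))
  have hbad : ∀ r ∈ S, (Bad r).card ≤ J ^ (n - 1) := by
    intro r hr
    have htr := ht r
    obtain ⟨i, hi⟩ : ∃ i, t r / n ≤ |(u r i : ℝ)| := by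
      by_contra! hc
      have h1 : ∑ i : Fin n, ((u r i : ℝ)) ^ 2 < ∑ i : Fin n, (t r / n) ^ 2 := by
        apply Finset.sum_lt_sum_of_nonempty
        · exact ⟨⟨0, hn⟩, Finset.mem_univ _⟩
        · intro i _
          rw [← sq_abs]
          exact pow_lt_pow_left₀ (hc i) (abs_nonneg _) (by norm_num)
      rw [← hnorm r] at h1
      simp only [Finset.sum_const, Finset.card_univ, Fintype.card_fin, nsmul_eq_mul] at h1
      have h2 : (n : ℝ) * (t r / n) ^ 2 = t r ^ 2 / n := by field_simp
      rw [h2, lt_div_iff₀ hn0] at h1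
      nlinarith [sq_nonneg (t r)]
    have hi2 : |(u r i : ℝ)| ≤ t r := by
      refine abs_le_of_sq_le_sq ?_ htr.le
      rw [hnorm r]
      exact Finset.single_le_sum (f := fun i => ((u r i : ℝ)) ^ 2)
        (fun i _ => sq_nonneg _) (Finset.mem_univ i)
    have hcard : Fintype.card ({k : Fin n // k ≠ i} → Fin J) = J ^ (n - 1) := by
      simp
    rw [← hcard, ← Finset.card_univ]
    apply Finset.card_le_card_of_injOn (fun j => fun k : {k : Fin n // k ≠ i} => j k)
    · intro j _; simp
    · intro j hj j' hj' hjj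
      simp only [Bad, Finset.coe_filter, Finset.mem_univ, true_and, Set.mem_ofPred_eq] at hj hj'
      obtain ⟨k, hk⟩ := hj
      obtain ⟨k', hk'⟩ := hj'
      have hoff : ∀ l, l ≠ i → j l = j' l := fun l hl => congrFun hjj ⟨l, hl⟩
      by_contra hne
      have hji : j i ≠ j' i := by
        intro he
        apply hne
        funext l
        by_cases hl : l = i
        · rw [hl, he]
        · exact hoff l hl
      set d : ℤ := ((j i : ℕ) : ℤ) - ((j' i : ℕ) : ℤ) with hd
      have hd0 : d ≠ 0 := by
        intro h0
        apply hji
        apply Fin.ext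
        omega
      have hd1 : (1 : ℝ) ≤ |(d : ℝ)| := by exact_mod_cast Int.one_le_abs hd0
      have hd2 : |(d : ℝ)| ≤ J := by
        have : |d| ≤ (J : ℤ) := by
          have := (j i).2
          have := (j' i).2
          rw [abs_le]; omega
        exact_mod_cast this
      have hdiff : (∑ l, (u r l : ℝ) * y j l) - (∑ l, (u r l : ℝ) * y j' l)
          = u r i * h * d := by
        rw [← Finset.sum_sub_distrib, Finset.sum_eq_single i]
        · simp only [y, hd]; push_cast; ring
        · intro l _ hl
          simp only [y, hoff l hl]; ring
        · simp
      have habs : |(u r i : ℝ) * h * d| = |(u r i : ℝ)| * h * |(d : ℝ)| := by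
        rw [abs_mul, abs_mul, abs_of_pos hh]
      have hw : 2 * (t r * h / (2 * n)) = t r / n * h := by field_simp
      have hclose : |(u r i : ℝ) * h * d - ((k - k' : ℤ) : ℝ)| < t r / n * h := by
        rw [← hdiff, ← hw]
        push_cast
        rw [abs_lt] at *
        constructor <;> linarith [hk.1, hk.2, hk'.1, hk'.2]
      have hlow : t r / n * h ≤ |(u r i : ℝ)| * h * |(d : ℝ)| := by
        have h1 : t r / n * h ≤ |(u r i : ℝ)| * h := by gcongr
        have h2 : 0 ≤ |(u r i : ℝ)| * h := by positivity
        nlinarith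
      have hup : |(u r i : ℝ)| * h * |(d : ℝ)| ≤ t r * h * J := by gcongr
      have hle : t r / n * h ≤ t r * h := by
        gcongr
        exact div_le_self htr.le hn'
      have hSr := hS r hr
      have hkk : k - k' = 0 := by
        by_contra h0
        have h1 : (1 : ℝ) ≤ |((k - k' : ℤ) : ℝ)| := by exact_mod_cast Int.one_le_abs h0
        have h2 := abs_sub_abs_le_abs_sub ((k - k' : ℤ) : ℝ) ((u r i : ℝ) * h * d)
        rw [abs_sub_comm] at h2
        nlinarith
      rw [hkk] at hclose
      simp only [Int.cast_zero, sub_zero] at hclose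
      linarith
  have hlt : (S.biUnion Bad).card < (Finset.univ : Finset (Fin n → Fin J)).card := by
    have h1 : (S.biUnion Bad).card ≤ S.card * J ^ (n - 1) :=
      Finset.card_biUnion_le_card_mul _ _ _ hbad
    have h2 : (Finset.univ : Finset (Fin n → Fin J)).card = J * J ^ (n - 1) := by
      rw [Finset.card_univ, Fintype.card_fun, Fintype.card_fin, Fintype.card_fin, ← pow_succ']
      congr 1; omega
    rw [h2]
    exact lt_of_le_of_lt h1 (Nat.mul_lt_mul_of_pos_right hJ (pow_pos (by omega) _))
  obtain ⟨j, _, hj⟩ := Finset.exists_mem_notMem_of_card_lt_card hlt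
  refine ⟨y j, ?_, ?_⟩
  · intro i
    have h1 : y j i - x i = h * ((j i : ℕ) : ℝ) := by simp [y]
    rw [h1, abs_of_nonneg (by positivity), mul_comm]
    have : ((j i : ℕ) : ℝ) ≤ J := by exact_mod_cast (j i).2.le
    gcongr
  · intro r hr k
    by_contra! hc
    exact hj (Finset.mem_biUnion.mpr ⟨r, hr, by simpa [Bad] using ⟨k, hc⟩⟩)

/-- The set is nonempty. -/
theorem lac_nonempty (n : ℕ) (hn : 0 < n) (M : ℝ) (hM : 1 < M)
    (t : ℕ → ℝ) (ht : ∀ r, 0 < t r) (hlac : ∀ r, M ≤ t (r + 1) / t r)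
    (u : ℕ → Fin n → ℤ) (hu : ∀ r, u r ≠ 0)
    (hnorm : ∀ r, (t r) ^ 2 = ∑ i : Fin n, ((u r i : ℝ)) ^ 2) :
    ∃ ξ : Fin n → ℝ, ∃ c > (0 : ℝ), ∀ r : ℕ, ∀ k : ℤ,
      c ≤ |∑ i : Fin n, (u r i : ℝ) * ξ i - k| := by
  classical
  have hn' : (1 : ℝ) ≤ n := by exact_mod_cast hn
  have hn0 : (0 : ℝ) < n := by linarith
  have hcoord : ∀ r i, |(u r i : ℝ)| ≤ t r := by
    intro r i
    refine abs_le_of_sq_le_sq ?_ (ht r).le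
    rw [hnorm r]
    exact Finset.single_le_sum (f := fun i => ((u r i : ℝ)) ^ 2)
      (fun i _ => sq_nonneg _) (Finset.mem_univ i)
  have ht1 : ∀ r, 1 ≤ t r := by
    intro r
    obtain ⟨i, hi⟩ := Function.ne_iff.mp (hu r)
    refine le_trans ?_ (hcoord r i)
    exact_mod_cast Int.one_le_abs hi
  have hgrow : ∀ r s, M ^ s * t r ≤ t (r + s) := by
    intro r s
    induction s with
    | zero => simp
    | succ s ih =>
      have h1 := hlac (r + s)
      rw [le_div_iff₀ (ht _)] at h1
      rw [← add_assoc, pow_succ]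
      have : M * (M ^ s * t r) ≤ M * t (r + s) := by gcongr
      nlinarith
  -- choice of the parameters
  obtain ⟨N, hN⟩ : ∃ N : ℕ, 8 * (n : ℝ) ^ 2 * (N + 1) ≤ M ^ N := by
    have h1 := tendsto_pow_const_div_const_pow_of_one_lt 1 hM
    have h0 := tendsto_pow_const_div_const_pow_of_one_lt 0 hM
    have h2 := (h1.add h0).const_mul (8 * (n : ℝ) ^ 2)
    simp only [add_zero, mul_zero] at h2
    obtain ⟨N, hN⟩ := (h2.eventually (gt_mem_nhds one_pos)).exists
    refine ⟨N, ?_⟩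
    have hp : 0 < M ^ N := by positivity
    rw [← add_div, ← mul_div_assoc, div_lt_one hp] at hN
    simpa using hN.le
  set J : ℕ := N + 1 with hJdef
  have hJ1 : (1 : ℝ) ≤ J := by rw [hJdef]; push_cast; linarith [(Nat.cast_nonneg N : (0 : ℝ) ≤ N)]
  set K : ℝ := 8 * (n : ℝ) ^ 2 * J with hKdef
  have hKM : K ≤ M ^ N := by rw [hKdef, hJdef]; push_cast; exact hN
  have hK8 : 8 ≤ K := by
    have : (1 : ℝ) ≤ (n : ℝ) ^ 2 := one_le_pow₀ hn'
    nlinarith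
  have hK0 : 0 < K := by linarith
  set h : ℝ := 1 / (K * (J + 1)) with hhdef
  have hh : 0 < h := by positivity
  let B : ℕ → Set ℕ := fun m => {r | K ^ m ≤ t r ∧ t r < K ^ (m + 1)}
  have hB : ∀ m, ∃ S : Finset ℕ, S.card < J ∧ ∀ r, r ∈ S ↔ r ∈ B m := by
    intro m
    by_cases hne : ∃ r, r ∈ B m
    · have hmin := Nat.find_spec hne
      set r0 := Nat.find hne
      refine ⟨(Finset.Ico r0 (r0 + N)).filter (fun r => r ∈ B m), ?_, ?_⟩
      · refine lt_of_le_of_lt (Finset.card_filter_le _ _) ?_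
        simp [hJdef]
      · intro r
        simp only [Finset.mem_filter, Finset.mem_Ico, and_iff_right_iff_imp]
        intro hr
        have h0 : r0 ≤ r := Nat.find_min' hne hr
        refine ⟨h0, ?_⟩
        by_contra! hc
        obtain ⟨s, rfl⟩ := Nat.exists_eq_add_of_le h0
        have h1 := hgrow r0 s
        have h2 : M ^ N ≤ M ^ s := pow_le_pow_right₀ hM.le (by omega)
        have h3 : K * K ^ m ≤ M ^ s * t r0 := by
          apply mul_le_mul (hKM.trans h2) hmin.1 (by positivity) (by positivity)
        have h4 := hr.2
        rw [pow_succ'] at h4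
        linarith
    · refine ⟨∅, by simp [hJdef], ?_⟩
      intro r
      simp only [Finset.notMem_empty, false_iff]
      exact fun hr => hne ⟨r, hr⟩
  choose S hScard hSmem using hB
  have hstep : ∀ m, ∀ x : Fin n → ℝ, ∃ y : Fin n → ℝ,
      (∀ i, |y i - x i| ≤ J * (h / K ^ m)) ∧
      ∀ r ∈ S m, ∀ k : ℤ, t r * (h / K ^ m) / (2 * n) ≤ |∑ i, (u r i : ℝ) * y i - k| := by
    intro m x
    apply lac_step n hn t ht u hnorm (S m) J (hScard m) (h / K ^ m) (by positivity)
    intro r hr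
    have h1 := ((hSmem m r).mp hr).2
    have h2 : K ^ (m + 1) * (h / K ^ m) * (J + 1) = 1 := by
      rw [hhdef, pow_succ]; field_simp
    have h3 : 0 < h / K ^ m := by positivity
    calc t r * (h / K ^ m) * (J + 1) < K ^ (m + 1) * (h / K ^ m) * (J + 1) := by gcongr
      _ = 1 := h2
  choose F hF1 hF2 using hstep
  let X : ℕ → Fin n → ℝ := fun m => Nat.rec 0 (fun m x => F m x) m
  have hX : ∀ m, X (m + 1) = F m (X m) := fun m => rfl
  have hdist : ∀ m, dist (X m) (X (m + 1)) ≤ (J * h) * (1 / K) ^ m := by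
    intro m
    rw [dist_pi_le_iff (by positivity)]
    intro i
    rw [Real.dist_eq, abs_sub_comm, hX]
    refine (hF1 m (X m) i).trans (le_of_eq ?_)
    rw [one_div, inv_pow]; ring
  have hK1 : 1 / K ≤ 1 / 2 := by
    apply one_div_le_one_div_of_le <;> linarith
  have hr1 : 1 / K < 1 := by linarith
  obtain ⟨ξ, hξ⟩ := cauchySeq_tendsto_of_complete
    (cauchySeq_of_le_geometric (1 / K) (J * h) hr1 hdist)
  refine ⟨ξ, h / (4 * n), by positivity, ?_⟩
  intro r k
  obtain ⟨m, hm1, hm2⟩ : ∃ m, K ^ m ≤ t r ∧ t r < K ^ (m + 1) :=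
    exists_nat_pow_near (ht1 r) (by linarith)
  have hlow := hF2 m (X m) r ((hSmem m r).mpr ⟨hm1, hm2⟩) k
  rw [← hX] at hlow
  have hd := dist_le_of_le_geometric_of_tendsto (1 / K) (J * h) hr1 hdist hξ (m + 1)
  have hd2 : dist (X (m + 1)) ξ ≤ 2 * (J * h) / K ^ (m + 1) := by
    refine hd.trans ?_
    rw [div_le_iff₀ (by linarith), one_div, inv_pow]
    have h1 : 1 / 2 ≤ 1 - K⁻¹ := by rw [← one_div]; linarith
    have h2 : 0 ≤ 2 * (J * h) / K ^ (m + 1) := by positivity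
    calc J * h * (K ^ (m + 1))⁻¹ = 2 * (J * h) / K ^ (m + 1) * (1 / 2) := by ring
      _ ≤ _ := by gcongr
  have herr : |∑ i, (u r i : ℝ) * X (m + 1) i - ∑ i, (u r i : ℝ) * ξ i|
      ≤ t r * (h / K ^ m) / (4 * n) := by
    rw [← Finset.sum_sub_distrib]
    calc |∑ i, ((u r i : ℝ) * X (m + 1) i - (u r i : ℝ) * ξ i)|
        ≤ ∑ i : Fin n, |(u r i : ℝ) * X (m + 1) i - (u r i : ℝ) * ξ i| :=
          Finset.abs_sum_le_sum_abs _ _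
      _ ≤ ∑ i : Fin n, t r * (2 * (J * h) / K ^ (m + 1)) := by
          apply Finset.sum_le_sum
          intro i _
          rw [← mul_sub, abs_mul]
          apply mul_le_mul (hcoord r i) _ (abs_nonneg _) (ht r).le
          rw [← Real.dist_eq]
          exact (dist_le_pi_dist _ _ i).trans hd2
      _ = t r * (h / K ^ m) / (4 * n) := by
          simp only [Finset.sum_const, Finset.card_univ, Fintype.card_fin, nsmul_eq_mul]
          have hJne : (J : ℝ) ≠ 0 := by positivity
          have hpow : K ^ (m + 1) = K ^ m * (8 * (n : ℝ) ^ 2 * J) := by rw [pow_succ]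
          rw [hpow]
          have hKm : K ^ m ≠ 0 := by positivity
          generalize K ^ m = Q at *
          field_simp
          ring
  have hfin : h / (4 * n) ≤ t r * (h / K ^ m) / (4 * n) := by
    gcongr
    rw [← mul_div_assoc, le_div_iff₀ (by positivity), mul_comm]
    gcongr
  have h2 : t r * (h / K ^ m) / (2 * n) = 2 * (t r * (h / K ^ m) / (4 * n)) := by
    field_simp; norm_num
  have h3 := abs_sub_le (∑ i, (u r i : ℝ) * X (m + 1) i) (∑ i, (u r i : ℝ) * ξ i) (k : ℝ)
  linarith

/-- For a lacunary sequence of integer vectors `u⁽ʳ⁾`, the set `N(Λ)` of `η`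
with `‖u⁽ʳ⁾ · η‖` uniformly bounded below is dense in `ℝ^n`. -/
theorem lacunary_bad_set_dense (n : ℕ) (hn : 0 < n) (M : ℝ) (hM : 1 < M)
    (t : ℕ → ℝ) (ht : ∀ r, 0 < t r) (hlac : ∀ r, M ≤ t (r + 1) / t r)
    (u : ℕ → Fin n → ℤ) (hu : ∀ r, u r ≠ 0)
    (hnorm : ∀ r, (t r) ^ 2 = ∑ i : Fin n, ((u r i : ℝ)) ^ 2) :
    Dense {η : Fin n → ℝ | ∃ c > (0 : ℝ),
        ∀ r : ℕ, c ≤ dnint (∑ i : Fin n, (u r i : ℝ) * η i)} := by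
  obtain ⟨ξ, c, hc, hξ⟩ := lac_nonempty n hn M hM t ht hlac u hu hnorm
  rw [Metric.dense_iff]
  intro x ε hε
  obtain ⟨q, hq⟩ := exists_nat_gt (1 / ε)
  have hq0 : (0 : ℝ) < q := lt_trans (by positivity) hq
  let p : Fin n → ℤ := fun i => ⌊q * x i - ξ i⌋
  refine ⟨fun i => (ξ i + p i) / q, ?_, c / q, by positivity, ?_⟩
  · rw [Metric.mem_ball, dist_pi_lt_iff hε]
    intro i
    rw [Real.dist_eq]
    have h1 := Int.floor_le (q * x i - ξ i)
    have h2 := Int.lt_floor_add_one (q * x i - ξ i)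
    have h3 : (ξ i + p i) / q - x i = (ξ i + p i - q * x i) / q := by field_simp
    rw [h3, abs_div, abs_of_pos hq0, div_lt_iff₀ hq0]
    have h4 : 1 < ε * q := by
      rw [div_lt_iff₀ hε] at hq; linarith
    refine lt_of_le_of_lt ?_ h4
    simp only [p]
    rw [abs_le]
    constructor <;> linarith
  · intro r
    apply le_ciInf
    intro k
    have h1 := hξ r (q * k - ∑ i, u r i * p i)
    have h2 : ∑ i : Fin n, (u r i : ℝ) * ((ξ i + p i) / q) - k
        = (∑ i : Fin n, (u r i : ℝ) * ξ i - ((q * k - ∑ i, u r i * p i : ℤ) : ℝ)) / q := by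
      push_cast
      have h3 : ∑ i : Fin n, (u r i : ℝ) * ((ξ i + p i) / q)
          = (∑ i : Fin n, (u r i : ℝ) * ξ i + ∑ i : Fin n, (u r i : ℝ) * p i) / q := by
        rw [← Finset.sum_add_distrib, Finset.sum_div]
        apply Finset.sum_congr rfl
        intro i _
        ring
      rw [h3]
      field_simp
      ring
    rw [h2, abs_div, abs_of_pos hq0]
    gcongr
end

section
/- Let n be a positive integer. For each k ≥ 1, let M_k > 1, let (t_r^{(k)})_{r≥1} be a sequence of positive reals with t_{r+1}^{(k)}/t_r^{(k)} ≥ M_k for all r, and let (u^{(k,r)})_{r≥1} be nonzero integer vectors in ℤ^n whose Euclidean norms equal t_r^{(k)}. Let N(Λ_k) = {η ∈ ℝ^n : there exists c > 0 such that ‖u_1^{(k,r)} η_1 + ⋯ + u_n^{(k,r)} η_n‖ ≥ c for all r}. Then the intersection ∩_{k≥1} N(Λ_k) has full Hausdorff dimension in ℝ^n, i.e. its Hausdorff dimension equals n. -/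
open scoped ENNReal

/-- The closed cube with lower corner `x` and side `d`. -/
def lbCube {n : ℕ} (x : Fin n → ℝ) (d : ℝ) : Set (Fin n → ℝ) :=
  {y | ∀ i, x i ≤ y i ∧ y i ≤ x i + d}

/-- Corner of the child cube. -/
def lbChild {n b : ℕ} (x : Fin n → ℝ) (d : ℝ) (v : Fin n → Fin b) : Fin n → ℝ :=
  fun i => x i + d * ((v i : ℕ) : ℝ)

lemma lbCube_child_subset {n b : ℕ} (x : Fin n → ℝ) (d e : ℝ) (hd : 0 ≤ d) (hde : d * b = e)
    (v : Fin n → Fin b) : lbCube (lbChild x d v) d ⊆ lbCube x e := by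
  intro y hy i
  have h := hy i
  simp only [lbChild] at h
  have h1 : ((v i : ℕ) : ℝ) + 1 ≤ b := by exact_mod_cast (v i).2
  have h0 : (0 : ℝ) ≤ ((v i : ℕ) : ℝ) := by positivity
  have h2 := mul_le_mul_of_nonneg_left h1 hd
  have h3 := mul_nonneg hd h0
  constructor <;> nlinarith

lemma lbCube_eq {n : ℕ} (x : Fin n → ℝ) (d : ℝ) :
    lbCube x d = Set.Icc x (fun i => x i + d) := by
  ext y
  simp [lbCube, Set.mem_Icc, Pi.le_def, forall_and]

open Classical in
lemma lb_core (n b : ℕ) (hb : 0 < b) {ι : Type*} (O : ι → Set (Fin n → ℝ)) (W N : ι → ℕ → ℝ≥0∞)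
    (h0 : ∑' i, W i 0 ≤ 2⁻¹) (hN : ∀ m, ∑' i, N i m ≤ 4⁻¹)
    (hstep : ∀ i m, W i (m+1) ≤ N i (m+1) ∨ ∀ x : Fin n → ℝ,
      2 * ((Finset.univ.filter (fun v : Fin n → Fin b =>
        (lbCube (lbChild x (((b:ℝ)⁻¹)^(m+1)) v) (((b:ℝ)⁻¹)^(m+1)) ∩ O i).Nonempty)).card : ℝ≥0∞)
        * W i (m+1) ≤ (b:ℝ≥0∞)^n * W i m)
    (hend : ∀ i, ∃ m, 1 ≤ W i m) : ∃ y, ∀ i, y ∉ O i := by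
  have : Nonempty (Fin b) := ⟨⟨0, hb⟩⟩
  set δ : ℕ → ℝ := fun m => ((b:ℝ)⁻¹)^m with hδ
  have hbR : (0:ℝ) < b := by exact_mod_cast hb
  have hδpos : ∀ m, 0 < δ m := fun m => by positivity
  have hδs : ∀ m, δ (m+1) * b = δ m := fun m => by
    simp only [hδ, pow_succ]; field_simp
  have hquart : (4⁻¹ : ℝ≥0∞) = 2⁻¹ * 2⁻¹ := by
    rw [← ENNReal.mul_inv (by simp) (by simp)]; norm_num
  have hhalf : (4⁻¹ : ℝ≥0∞) + 4⁻¹ = 2⁻¹ := by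
    rw [hquart, ← mul_add, ENNReal.inv_two_add_inv_two, mul_one]
  let φ : ℕ → (Fin n → ℝ) → ℝ≥0∞ := fun m x =>
    ∑' i, if (lbCube x (δ m) ∩ O i).Nonempty then W i m else 0
  have key : ∀ m x, φ m x ≤ 2⁻¹ → ∃ v : Fin n → Fin b, φ (m+1) (lbChild x (δ (m+1)) v) ≤ 2⁻¹ := by
    intro m x hφ
    by_contra hcon
    push Not at hcon
    have hlt := ENNReal.sum_lt_sum_of_nonempty (s := (Finset.univ : Finset (Fin n → Fin b)))
      Finset.univ_nonempty (fun v _ => hcon v)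
    rw [Finset.sum_const, Finset.card_univ, nsmul_eq_mul] at hlt
    simp only [Fintype.card_pi, Fintype.card_fin, Finset.prod_const, Finset.card_univ,
      Nat.cast_pow] at hlt
    refine absurd hlt (not_lt.mpr ?_)
    have hsum : ∀ i, ∑ v : Fin n → Fin b,
        (if (lbCube (lbChild x (δ (m+1)) v) (δ (m+1)) ∩ O i).Nonempty then W i (m+1) else 0)
        ≤ (b:ℝ≥0∞)^n * (2⁻¹ * (if (lbCube x (δ m) ∩ O i).Nonempty then W i m else 0)
          + N i (m+1)) := by
      intro i
      rcases hstep i m with h | h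
      · calc _ ≤ ∑ v : Fin n → Fin b, N i (m+1) := by
              apply Finset.sum_le_sum
              intro v _
              split_ifs
              · exact h
              · exact zero_le
          _ = (b:ℝ≥0∞)^n * N i (m+1) := by simp
          _ ≤ _ := by gcongr; exact le_add_self
      · by_cases hit : (lbCube x (δ m) ∩ O i).Nonempty
        · rw [if_pos hit, ← Finset.sum_filter, Finset.sum_const, nsmul_eq_mul]
          have h2 := h x
          calc _ = 2⁻¹ * (2 * ((Finset.univ.filter (fun v : Fin n → Fin b =>
                (lbCube (lbChild x (δ (m+1)) v) (δ (m+1)) ∩ O i).Nonempty)).card : ℝ≥0∞)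
                * W i (m+1)) := by
                  rw [← mul_assoc, ← mul_assoc, ENNReal.inv_mul_cancel (by simp) (by simp), one_mul]
            _ ≤ 2⁻¹ * ((b:ℝ≥0∞)^n * W i m) := by gcongr
            _ = (b:ℝ≥0∞)^n * (2⁻¹ * W i m) := by ring
            _ ≤ _ := by gcongr; exact le_self_add
        · rw [Finset.sum_eq_zero]
          · exact zero_le
          · intro v _
            rw [if_neg]
            intro hv
            exact hit (hv.mono (Set.inter_subset_inter_left _
              (lbCube_child_subset x _ _ (hδpos _).le (hδs m) v)))
    calc ∑ v : Fin n → Fin b, φ (m+1) (lbChild x (δ (m+1)) v)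
        = ∑' i, ∑ v : Fin n → Fin b,
          (if (lbCube (lbChild x (δ (m+1)) v) (δ (m+1)) ∩ O i).Nonempty then W i (m+1) else 0) := by
          rw [Summable.tsum_finsetSum (fun _ _ => ENNReal.summable)]
      _ ≤ ∑' i, (b:ℝ≥0∞)^n * (2⁻¹ * (if (lbCube x (δ m) ∩ O i).Nonempty then W i m else 0)
          + N i (m+1)) := ENNReal.tsum_le_tsum hsum
      _ = (b:ℝ≥0∞)^n * (2⁻¹ * φ m x + ∑' i, N i (m+1)) := by
          rw [ENNReal.tsum_mul_left, ENNReal.tsum_add, ENNReal.tsum_mul_left]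
      _ ≤ (b:ℝ≥0∞)^n * (2⁻¹ * 2⁻¹ + 4⁻¹) := by gcongr; exact hN _
      _ = (b:ℝ≥0∞)^n * 2⁻¹ := by rw [← hquart, hhalf]
  choose! g hg using key
  let x : ℕ → Fin n → ℝ := fun m => Nat.rec 0 (fun m x => lbChild x (δ (m+1)) (g m x)) m
  have hx : ∀ m, x (m+1) = lbChild (x m) (δ (m+1)) (g m (x m)) := fun m => rfl
  have hφ : ∀ m, φ m (x m) ≤ 2⁻¹ := by
    intro m
    induction m with
    | zero =>
      refine le_trans (ENNReal.tsum_le_tsum fun i => ?_) h0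
      split_ifs
      · exact le_rfl
      · exact zero_le
    | succ m ih => rw [hx]; exact hg m _ ih
  obtain ⟨y, hy⟩ := IsCompact.nonempty_iInter_of_sequence_nonempty_isCompact_isClosed
    (fun m => lbCube (x m) (δ m))
    (fun m => by
      rw [hx]; exact lbCube_child_subset _ _ _ (hδpos _).le (hδs m) _)
    (fun m => ⟨x m, fun i => ⟨le_rfl, by linarith [hδpos m]⟩⟩)
    (by rw [lbCube_eq]; exact isCompact_Icc)
    (fun m => by rw [lbCube_eq]; exact isClosed_Icc)
  refine ⟨y, fun i hi => ?_⟩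
  obtain ⟨m, hm⟩ := hend i
  have h1 : W i m ≤ φ m (x m) := by
    refine le_trans ?_ (ENNReal.le_tsum i)
    rw [if_pos ⟨y, Set.mem_iInter.mp hy m, hi⟩]
  have h2 := hm.trans (h1.trans (hφ m))
  have h3 : (2⁻¹ : ℝ≥0∞) < 1 := by
    rw [ENNReal.inv_lt_one]; norm_num
  exact absurd h2 (not_le.mpr h3)

/-- Naturals pairwise within distance `K`: there are boundedly many of them. -/
lemma lb_card_fin {b : ℕ} (S : Finset (Fin b)) (K : ℕ)
    (h : ∀ p ∈ S, ∀ q ∈ S, |((p:ℕ):ℝ) - ((q:ℕ):ℝ)| ≤ K) : S.card ≤ 2*K+1 := by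
  rcases S.eq_empty_or_nonempty with rfl | ⟨q, hq⟩
  · simp
  · have : (S.image (fun p : Fin b => (p:ℕ))) ⊆ Finset.Icc ((q:ℕ) - K) ((q:ℕ) + K) := by
      intro p hp
      obtain ⟨p, hpS, rfl⟩ := Finset.mem_image.mp hp
      have h1 := abs_le.mp (h p hpS q hq)
      have h2 : ((p:ℕ):ℝ) ≤ ((q:ℕ) + K : ℕ) := by push_cast; linarith
      have h3 : ((q:ℕ):ℝ) ≤ ((p:ℕ) + K : ℕ) := by push_cast; linarith
      rw [Nat.cast_le] at h2 h3
      rw [Finset.mem_Icc]; omega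
    have h4 := Finset.card_le_card this
    rw [Finset.card_image_of_injective _ Fin.val_injective, Nat.card_Icc] at h4
    omega

open Classical in
lemma lb_count_set {n b : ℕ} (x : Fin n → ℝ) (d : ℝ) (hd : 0 < d) (U : Set (Fin n → ℝ))
    (hU : Metric.ediam U ≤ ENNReal.ofReal d) :
    (Finset.univ.filter (fun v : Fin n → Fin b =>
        (lbCube (lbChild x d v) d ∩ U).Nonempty)).card ≤ 5 ^ n := by
  set S := (Finset.univ.filter (fun v : Fin n → Fin b =>
        (lbCube (lbChild x d v) d ∩ U).Nonempty)) with hS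
  have hsub : S ⊆ Fintype.piFinset (fun i => S.image (fun v => v i)) := by
    intro v hv
    rw [Fintype.mem_piFinset]
    intro i
    exact Finset.mem_image_of_mem _ hv
  refine (Finset.card_le_card hsub).trans ?_
  rw [Fintype.card_piFinset]
  refine (Finset.prod_le_prod' (g := fun _ => 5) fun i _ => ?_).trans (by simp)
  refine lb_card_fin _ 2 ?_
  intro p hp q hq
  obtain ⟨v, hv, rfl⟩ := Finset.mem_image.mp hp
  obtain ⟨w, hw, rfl⟩ := Finset.mem_image.mp hq
  obtain ⟨y, hy, hyU⟩ := (Finset.mem_filter.mp hv).2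
  obtain ⟨z, hz, hzU⟩ := (Finset.mem_filter.mp hw).2
  have h1 : edist y z ≤ ENNReal.ofReal d := (Metric.edist_le_ediam_of_mem hyU hzU).trans hU
  rw [edist_dist, ENNReal.ofReal_le_ofReal_iff hd.le] at h1
  have h2 := abs_le.mp ((Real.dist_eq _ _ ▸ dist_le_pi_dist y z i).trans h1)
  have hy1 := hy i
  have hz1 := hz i
  simp only [lbChild] at hy1 hz1
  push_cast
  rw [abs_le]
  constructor <;> nlinarith

open Classical in
lemma lb_count_slab {n b : ℕ} (x : Fin n → ℝ) (d c : ℝ) (hd : 0 < d) (U : Set (Fin n → ℝ))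
    (a : Fin n → ℝ) (i : Fin n) (ha : ∀ j, |a j| ≤ |a i|) (hai : 0 < |a i|)
    (hc : 2 * c ≤ d * |a i|)
    (hU : ∀ y ∈ U, ∀ z ∈ U, (∀ j, |y j - z j| ≤ d * b) → |∑ j, a j * (y j - z j)| ≤ 2 * c) :
    (Finset.univ.filter (fun v : Fin n → Fin b =>
        (lbCube (lbChild x d v) d ∩ U).Nonempty)).card * b ≤ (2 * n + 3) * b ^ n := by
  set S := (Finset.univ.filter (fun v : Fin n → Fin b =>
        (lbCube (lbChild x d v) d ∩ U).Nonempty)) with hS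
  -- forget the coordinate `i`
  obtain ⟨n, rfl⟩ : ∃ k, n = k + 1 := ⟨n - 1, by have := i.2; omega⟩
  have hcard : S.card ≤ (2 * (n+1) + 3) * (S.image (fun v => i.removeNth v)).card := by
    apply Finset.card_le_mul_card_image
    intro r _
    have : ((S.filter (fun v => i.removeNth v = r)).image (fun v => v i)).card
        = (S.filter (fun v => i.removeNth v = r)).card := by
      apply Finset.card_image_of_injOn
      intro v hv w hw hvw
      have h1 := (Finset.mem_filter.mp hv).2
      have h2 := (Finset.mem_filter.mp hw).2
      rw [← Fin.insertNth_self_removeNth i v, ← Fin.insertNth_self_removeNth i w, h1, h2]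
      congr 1
    rw [← this]
    have h5 : 2 * (n+1) + 3 = 2 * (n + 2) + 1 := by ring
    rw [h5]
    apply lb_card_fin
    intro p hp q hq
    obtain ⟨v, hv, rfl⟩ := Finset.mem_image.mp hp
    obtain ⟨w, hw, rfl⟩ := Finset.mem_image.mp hq
    have hvw : ∀ j, j ≠ i → v j = w j := by
      intro j hj
      obtain ⟨k, rfl⟩ := Fin.exists_succAbove_eq hj
      have h1 := (Finset.mem_filter.mp hv).2
      have h2 := (Finset.mem_filter.mp hw).2
      exact congrFun (h1.trans h2.symm) k
    obtain ⟨y, hy, hyU⟩ := (Finset.mem_filter.mp (Finset.mem_filter.mp hv).1).2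
    obtain ⟨z, hz, hzU⟩ := (Finset.mem_filter.mp (Finset.mem_filter.mp hw).1).2
    have hy' := lbCube_child_subset x d (d * b) hd.le rfl v hy
    have hz' := lbCube_child_subset x d (d * b) hd.le rfl w hz
    have h6 := hU y hyU z hzU (fun j => by
      have := hy' j; have := hz' j; rw [abs_le]; constructor <;> linarith)
    -- decomposition
    set θ : Fin (n+1) → ℝ := fun j => (y j - lbChild x d v j) - (z j - lbChild x d w j) with hθ
    have hθb : ∀ j, |θ j| ≤ d := by
      intro j
      have := hy j; have := hz j
      simp only [hθ]; rw [abs_le]; constructor <;> linarith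
    have hdec : ∑ j, a j * (y j - z j)
        = a i * (d * (((v i:ℕ):ℝ) - ((w i:ℕ):ℝ))) + ∑ j, a j * θ j := by
      have : ∀ j, a j * (y j - z j) = a j * (d * (((v j:ℕ):ℝ) - ((w j:ℕ):ℝ))) + a j * θ j := by
        intro j; simp only [hθ, lbChild]; ring
      rw [Finset.sum_congr rfl (fun j _ => this j), Finset.sum_add_distrib]
      congr 1
      rw [Finset.sum_eq_single i]
      · intro j _ hj; rw [hvw j hj]; simp
      · simp
    have hsumθ : |∑ j, a j * θ j| ≤ (n+1) * (|a i| * d) := by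
      refine (Finset.abs_sum_le_sum_abs _ _).trans ?_
      refine (Finset.sum_le_sum (g := fun _ => |a i| * d) fun j _ => ?_).trans (by simp)
      rw [abs_mul]
      exact mul_le_mul (ha j) (hθb j) (abs_nonneg _) hai.le
    have h7 : |a i * (d * (((v i:ℕ):ℝ) - ((w i:ℕ):ℝ)))| ≤ 2 * c + (n+1) * (|a i| * d) := by
      have : a i * (d * (((v i:ℕ):ℝ) - ((w i:ℕ):ℝ))) =
        ∑ j, a j * (y j - z j) - ∑ j, a j * θ j := by rw [hdec]; ring
      rw [this]
      exact (abs_sub _ _).trans (add_le_add h6 hsumθ)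
    rw [abs_mul, abs_mul, abs_of_pos hd] at h7
    have hpos : 0 < |a i| * d := by positivity
    push_cast
    refine le_of_mul_le_mul_left ?_ hpos
    nlinarith
  have h8 : (S.image (fun v => i.removeNth v)).card ≤ b ^ n := by
    refine (Finset.card_le_univ _).trans ?_
    simp
  calc S.card * b ≤ (2 * (n+1) + 3) * b ^ n * b :=
        Nat.mul_le_mul_right _ (hcard.trans (Nat.mul_le_mul_left _ h8))
    _ = _ := by rw [pow_succ]; ring

lemma lb_exists_lvl {b : ℕ} (hb : 2 ≤ b) {s : ℝ} (hs : 0 < s) (d ε : ℝ≥0∞) (hd : d ≤ 1)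
    (hε : 0 < ε) : ∃ l : ℕ, d ≤ ENNReal.ofReal (((b:ℝ)⁻¹)^l) ∧
      (((b:ℝ≥0∞)^s)⁻¹)^l ≤ (b:ℝ≥0∞)^s * d^s + ε := by
  have hbR : (1:ℝ) < b := by exact_mod_cast hb
  have hbE : (1:ℝ≥0∞) < b := by exact_mod_cast hb
  have hconv : ∀ l : ℕ, ENNReal.ofReal (((b:ℝ)⁻¹)^l) = ((b:ℝ≥0∞)⁻¹)^l := by
    intro l
    rw [ENNReal.ofReal_pow (by positivity), ENNReal.ofReal_inv_of_pos (by linarith),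
      ENNReal.ofReal_natCast]
  have hq : ∀ l : ℕ, (((b:ℝ≥0∞)^s)⁻¹)^l = (((b:ℝ≥0∞)⁻¹)^l)^s := by
    intro l
    rw [← ENNReal.inv_rpow, ← ENNReal.rpow_natCast, ← ENNReal.rpow_natCast, ← ENNReal.rpow_mul,
      ← ENNReal.rpow_mul, mul_comm]
  rcases eq_or_ne d 0 with rfl | hd0
  · have hlt : ((b:ℝ≥0∞)^s)⁻¹ < 1 := by
      rw [ENNReal.inv_lt_one]
      exact ENNReal.one_lt_rpow hbE hs
    obtain ⟨l, hl⟩ := ((ENNReal.tendsto_pow_atTop_nhds_zero_of_lt_one hlt).eventually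
      (gt_mem_nhds hε)).exists
    exact ⟨l, zero_le, hl.le.trans le_add_self⟩
  · have hdt : d ≠ ∞ := ne_top_of_le_ne_top (by simp) hd
    have hd1 : d.toReal ≤ 1 := by
      have := ENNReal.toReal_mono (by simp) hd
      simpa using this
    obtain ⟨l, hl1, hl2⟩ := exists_nat_pow_near_of_lt_one (ENNReal.toReal_pos hd0 hdt) hd1
      (y := (b:ℝ)⁻¹) (by positivity) (inv_lt_one_of_one_lt₀ hbR)
    refine ⟨l, (ENNReal.le_ofReal_iff_toReal_le hdt (by positivity)).mpr hl2, ?_⟩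
    refine le_trans ?_ le_self_add
    have h1 : ((b:ℝ≥0∞)⁻¹)^(l+1) ≤ d := by
      rw [← hconv]
      exact ENNReal.ofReal_le_of_le_toReal hl1.le
    have h2 : ((b:ℝ≥0∞)⁻¹)^l = b * ((b:ℝ≥0∞)⁻¹)^(l+1) := by
      rw [pow_succ, mul_comm (((b:ℝ≥0∞)⁻¹)^l), ← mul_assoc, ENNReal.mul_inv_cancel, one_mul]
      · exact (zero_lt_one.trans hbE).ne'
      · simp
    rw [hq, h2, ENNReal.mul_rpow_of_nonneg _ _ hs.le]
    gcongr

lemma lb_exists_base (n : ℕ) {s : ℝ} (hs : s < n) : ∃ b : ℕ, 2 ≤ b ∧ 8 * (2 * n + 3) ≤ b ∧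
    2 * (5:ℝ≥0∞)^n * (b:ℝ≥0∞)^s ≤ (b:ℝ≥0∞)^n := by
  have h1 := (tendsto_rpow_atTop (sub_pos.mpr hs)).comp (tendsto_natCast_atTop_atTop (R := ℝ))
  obtain ⟨b, hb1, hb2⟩ := ((h1.eventually_ge_atTop (2 * 5^n)).and
    (Filter.eventually_ge_atTop (8 * (2 * n + 3)))).exists
  refine ⟨b, by omega, hb2, ?_⟩
  have hb0 : (0:ℝ) < b := by
    have : 0 < b := by omega
    exact_mod_cast this
  have h2 : 2 * (5:ℝ)^n * (b:ℝ)^s ≤ (b:ℝ)^n := by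
    have h3 : (b:ℝ)^((n:ℝ) - s) * (b:ℝ)^s = (b:ℝ)^n := by
      rw [← Real.rpow_add hb0, sub_add_cancel, Real.rpow_natCast]
    rw [← h3]
    exact mul_le_mul_of_nonneg_right hb1 (by positivity)
  have h4 := ENNReal.ofReal_le_ofReal h2
  rw [ENNReal.ofReal_mul (by positivity), ENNReal.ofReal_mul (by positivity),
    ENNReal.ofReal_pow (by positivity), ENNReal.ofReal_pow (by positivity),
    ← ENNReal.ofReal_rpow_of_pos hb0, ENNReal.ofReal_natCast] at h4
  simpa using h4

lemma lb_dnint_close {p q c : ℝ} (hp : dnint p < c) (hq : dnint q < c) (hc : c ≤ 4⁻¹)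
    (hpq : |p - q| ≤ 2⁻¹) : |p - q| ≤ 2 * c := by
  obtain ⟨k, hk⟩ := exists_lt_of_ciInf_lt hp
  obtain ⟨l, hl⟩ := exists_lt_of_ciInf_lt hq
  rw [abs_lt] at hk hl
  rw [abs_le] at hpq ⊢
  have h1 : (k:ℝ) < l + 1 := by linarith
  have h2 : (l:ℝ) < k + 1 := by linarith
  have h1' : k < l + 1 := by exact_mod_cast h1
  have h2' : l < k + 1 := by exact_mod_cast h2
  have h3 : k = l := by omega
  subst h3
  constructor <;> linarith

open Classical in
lemma lb_slab_bound {n b : ℕ} (hn : 0 < n) (hb : 8 * (2 * n + 3) ≤ b) (u : Fin n → ℤ) (T : ℝ)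
    (hT : 0 < T) (hu : T ^ 2 = ∑ i, (u i : ℝ)^2) (a j m : ℕ) (h1 : 2 * n * T ≤ (b:ℝ)^a)
    (h2 : (b:ℝ)^a ≤ b * (2 * n * T)) (ham : a ≤ m) (hmj : m + 1 ≤ a + j) (x : Fin n → ℝ) :
    8 * (Finset.univ.filter (fun v : Fin n → Fin b =>
        (lbCube (lbChild x (((b:ℝ)⁻¹)^(m+1)) v) (((b:ℝ)⁻¹)^(m+1)) ∩
          {η | dnint (∑ i, (u i : ℝ) * η i) < ((b:ℝ)⁻¹)^j / (4 * n^2 * b)}).Nonempty)).card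
        ≤ b ^ n := by
  have hb0 : 0 < b := by omega
  have hbR : (1:ℝ) ≤ b := by exact_mod_cast hb0
  have hbR0 : (0:ℝ) < b := by linarith
  have hnR : (1:ℝ) ≤ n := by exact_mod_cast hn
  have hinv : (b:ℝ)⁻¹ ≤ 1 := inv_le_one_of_one_le₀ hbR
  set c : ℝ := ((b:ℝ)⁻¹)^j / (4 * n^2 * b) with hc
  have hc4 : c ≤ 4⁻¹ := by
    have h3 : ((b:ℝ)⁻¹)^j ≤ 1 := pow_le_one₀ (by positivity) hinv
    have h4 : (1:ℝ) ≤ n^2 * b := by nlinarith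
    rw [hc, div_le_iff₀ (by positivity)]
    nlinarith
  have hle : ∀ i, |(u i : ℝ)| ≤ T := by
    intro i
    apply abs_le_of_sq_le_sq _ hT.le
    rw [hu]
    exact Finset.single_le_sum (f := fun i => (u i : ℝ)^2) (fun _ _ => sq_nonneg _)
      (Finset.mem_univ i)
  have : Nonempty (Fin n) := ⟨⟨0, hn⟩⟩
  obtain ⟨i, -, hi⟩ := Finset.exists_max_image Finset.univ (fun i => |(u i : ℝ)|)
    Finset.univ_nonempty
  have hi' : ∀ k, |(u k : ℝ)| ≤ |(u i : ℝ)| := fun k => hi k (Finset.mem_univ k)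
  have hTi : T ≤ n * |(u i : ℝ)| := by
    apply le_of_sq_le_sq _ (by positivity)
    rw [hu]
    calc ∑ k, (u k : ℝ)^2 ≤ ∑ k : Fin n, |(u i : ℝ)|^2 := by
          apply Finset.sum_le_sum
          intro k _
          rw [← sq_abs]
          exact pow_le_pow_left₀ (abs_nonneg _) (hi' k) 2
      _ = n * |(u i : ℝ)|^2 := by simp
      _ ≤ (n * |(u i : ℝ)|)^2 := by
          rw [mul_pow]
          apply mul_le_mul_of_nonneg_right _ (by positivity)
          nlinarith
  have hui : 0 < |(u i : ℝ)| := by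
    by_contra h
    have : |(u i : ℝ)| = 0 := le_antisymm (not_lt.mp h) (abs_nonneg _)
    rw [this] at hTi
    linarith
  have hcount := lb_count_slab (b := b) x (((b:ℝ)⁻¹)^(m+1)) c (by positivity)
    {η | dnint (∑ i, (u i : ℝ) * η i) < c} (fun k => (u k : ℝ)) i hi' hui ?_ ?_
  · have h5 : (Finset.univ.filter (fun v : Fin n → Fin b =>
        (lbCube (lbChild x (((b:ℝ)⁻¹)^(m+1)) v) (((b:ℝ)⁻¹)^(m+1)) ∩
          {η | dnint (∑ i, (u i : ℝ) * η i) < c}).Nonempty)).card * (8 * (2 * n + 3))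
          ≤ (2 * n + 3) * b ^ n := (Nat.mul_le_mul_left _ hb).trans hcount
    have h6 : 0 < 2 * n + 3 := by omega
    refine Nat.le_of_mul_le_mul_left ?_ h6
    refine le_trans (le_of_eq ?_) h5
    ring
  · -- size of `c`
    have h7 : ((b:ℝ)⁻¹)^(a+j) ≤ ((b:ℝ)⁻¹)^(m+1) :=
      pow_le_pow_of_le_one (by positivity) hinv hmj
    refine le_trans ?_ (mul_le_mul_of_nonneg_right h7 hui.le)
    rw [pow_add, hc]
    have h8 : (b:ℝ)^a ≤ b * (2 * n * (n * |(u i : ℝ)|)) := by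
      refine h2.trans ?_
      gcongr
    have h9 : 1 / (2 * n^2 * b) ≤ ((b:ℝ)⁻¹)^a * |(u i : ℝ)| := by
      rw [inv_pow, div_le_iff₀ (by positivity), inv_mul_eq_div, div_mul_eq_mul_div,
        le_div_iff₀ (by positivity)]
      nlinarith
    have h10 := mul_le_mul_of_nonneg_left h9 (show 0 ≤ ((b:ℝ)⁻¹)^j by positivity)
    calc 2 * (((b:ℝ)⁻¹)^j / (4 * n^2 * b)) = ((b:ℝ)⁻¹)^j * (1 / (2 * n^2 * b)) := by
          field_simp; norm_num
      _ ≤ _ := h10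
      _ = _ := by ring
  · intro y hy z hz hyz
    have h11 : ∑ k, (u k : ℝ) * (y k - z k) = ∑ k, (u k : ℝ) * y k - ∑ k, (u k : ℝ) * z k := by
      rw [← Finset.sum_sub_distrib]
      exact Finset.sum_congr rfl fun k _ => by ring
    have h12 : ((b:ℝ)⁻¹)^(m+1) * b = ((b:ℝ)⁻¹)^m := by
      rw [pow_succ]; field_simp
    rw [h12] at hyz
    have h13 : ((b:ℝ)⁻¹)^m ≤ ((b:ℝ)⁻¹)^a := pow_le_pow_of_le_one (by positivity) hinv ham
    have h14 : |∑ k, (u k : ℝ) * (y k - z k)| ≤ 2⁻¹ := by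
      calc _ ≤ ∑ k, |(u k : ℝ) * (y k - z k)| := Finset.abs_sum_le_sum_abs _ _
        _ ≤ ∑ k : Fin n, T * ((b:ℝ)⁻¹)^a := by
            apply Finset.sum_le_sum
            intro k _
            rw [abs_mul]
            exact mul_le_mul (hle k) ((hyz k).trans h13) (abs_nonneg _) hT.le
        _ = (n * T) / (b:ℝ)^a := by simp; field_simp
        _ ≤ 2⁻¹ := by
            rw [div_le_iff₀ (by positivity)]
            linarith
    rw [h11] at h14 ⊢
    exact lb_dnint_close hy hz hc4 h14

open Classical in
lemma lb_count_lvl {b n : ℕ} (hn : 0 < n) (M : ℝ) (hM : 1 < M) (t : ℕ → ℝ) (ht : ∀ r, 0 < t r)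
    (hlac : ∀ r, M ≤ t (r+1) / t r) (a : ℕ → ℕ) (L : ℕ) (hL : (b:ℝ) < M^L)
    (h1 : ∀ r, 2 * n * t r ≤ (b:ℝ)^(a r)) (h2 : ∀ r, (b:ℝ)^(a r) ≤ b * (2 * n * t r))
    (m : ℕ) (w : ℝ≥0∞) : ∑' r, (if a r = m then w else 0) ≤ L * w := by
  have hnR : (0:ℝ) < n := by exact_mod_cast hn
  have hmul : ∀ r k, M^k * t r ≤ t (r + k) := by
    intro r k
    induction k with
    | zero => simp
    | succ k ih =>
      have h3 := (le_div_iff₀ (ht (r+k))).mp (hlac (r+k))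
      rw [pow_succ, ← add_assoc]
      calc M^k * M * t r = M * (M^k * t r) := by ring
        _ ≤ M * t (r+k) := by gcongr
        _ ≤ _ := h3
  by_cases hex : ∃ r, a r = m
  · have hr0 := Nat.find_spec hex
    set r0 := Nat.find hex with hr0d
    have hsupp : ∀ r, r ∉ Finset.Ico r0 (r0 + L) → (if a r = m then w else 0) = 0 := by
      intro r hr
      rw [if_neg]
      intro har
      have hr1 : r0 ≤ r := Nat.find_min' hex har
      have hr2 : r0 + L ≤ r := by
        by_contra h
        exact hr (Finset.mem_Ico.mpr ⟨hr1, by omega⟩)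
      obtain ⟨k, rfl⟩ := Nat.exists_eq_add_of_le hr1
      have h3 := hmul r0 k
      have h4 : M^L ≤ M^k := pow_le_pow_right₀ hM.le (by omega)
      have h5 : b * t r0 < t (r0 + k) :=
        lt_of_lt_of_le (mul_lt_mul_of_pos_right (hL.trans_le h4) (ht r0)) h3
      have h6 := h1 (r0 + k)
      have h7 := h2 r0
      rw [har] at h6
      rw [hr0] at h7
      have h8 : 2 * n * (b * t r0) < 2 * n * t (r0+k) :=
        mul_lt_mul_of_pos_left h5 (by positivity)
      linarith
    rw [tsum_eq_sum hsupp]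
    calc _ ≤ ∑ r ∈ Finset.Ico r0 (r0 + L), w := by
          apply Finset.sum_le_sum
          intro r _
          split_ifs
          · exact le_rfl
          · exact zero_le
      _ = L * w := by simp
  · push Not at hex
    simp [hex]

lemma lb_exists_depth (L : ℕ) (ε : ℝ≥0∞) (hε : 0 < ε) : ∃ j : ℕ, (L:ℝ≥0∞) * (4⁻¹)^j ≤ ε := by
  have h1 : (4⁻¹ : ℝ≥0∞) < 1 := by rw [ENNReal.inv_lt_one]; norm_num
  have h2 := ENNReal.Tendsto.const_mul (a := (L:ℝ≥0∞))
    (ENNReal.tendsto_pow_atTop_nhds_zero_of_lt_one h1) (Or.inr (by simp))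
  rw [mul_zero] at h2
  obtain ⟨j, hj⟩ := (h2.eventually (gt_mem_nhds hε)).exists
  exact ⟨j, hj.le⟩

lemma lb_arith {K B w : ℝ≥0∞} {e f : ℕ} (h5 : f = e + 1) (h : 2 * K ≤ B * w) :
    2 * K * w^e ≤ B * w^f := by
  calc 2 * K * w^e ≤ B * w * w^e := mul_le_mul_left h _
    _ = B * w^f := by rw [h5, pow_succ]; ring

lemma lb_four {K b n : ℕ} (h : 8 * K ≤ b^n) : 2 * (K:ℝ≥0∞) ≤ (b:ℝ≥0∞)^n * 4⁻¹ := by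
  have h4 : (8:ℝ≥0∞) * K ≤ (b:ℝ≥0∞)^n := by exact_mod_cast h
  calc (2:ℝ≥0∞) * K = 8 * K * 4⁻¹ := by
        have : (8:ℝ≥0∞) = 2 * 4 := by norm_num
        rw [this, mul_right_comm (2 * 4 : ℝ≥0∞), mul_assoc (2:ℝ≥0∞) 4,
          ENNReal.mul_inv_cancel (by simp) (by simp), mul_one]
    _ ≤ _ := mul_le_mul_left h4 _

lemma lb_five {K n : ℕ} {q B : ℝ≥0∞} (h : K ≤ 5^n) (hq0 : q ≠ 0) (hqt : q ≠ ∞)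
    (hB : 2 * 5^n * q ≤ B) : 2 * (K:ℝ≥0∞) ≤ B * q⁻¹ := by
  have h4 : (K:ℝ≥0∞) ≤ 5^n := by exact_mod_cast h
  calc (2:ℝ≥0∞) * K ≤ 2 * 5^n := mul_le_mul_right h4 _
    _ = 2 * 5^n * q * q⁻¹ := by
      rw [mul_assoc (2 * 5^n : ℝ≥0∞), ENNReal.mul_inv_cancel hq0 hqt, mul_one]
    _ ≤ _ := mul_le_mul_left hB _

theorem lacunary_bad_sets_intersection_full_dimension (n : ℕ) (hn : 0 < n)
    (M : ℕ → ℝ) (hM : ∀ k, 1 < M k)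
    (t : ℕ → ℕ → ℝ) (ht : ∀ k r, 0 < t k r)
    (hlac : ∀ k r, M k ≤ t k (r + 1) / t k r)
    (u : ℕ → ℕ → Fin n → ℤ) (hu : ∀ k r, u k r ≠ 0)
    (hnorm : ∀ k r, (t k r) ^ 2 = ∑ i : Fin n, ((u k r i : ℝ)) ^ 2) :
    dimH (⋂ k : ℕ, {η : Fin n → ℝ | ∃ c > (0 : ℝ),
        ∀ r : ℕ, c ≤ dnint (∑ i : Fin n, (u k r i : ℝ) * η i)}) = (n : ℕ) := by
  classical
  apply le_antisymm
  · exact (dimH_mono (Set.subset_univ _)).trans (Real.dimH_univ_pi_fin n).le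
  set E := (⋂ k : ℕ, {η : Fin n → ℝ | ∃ c > (0 : ℝ),
        ∀ r : ℕ, c ≤ dnint (∑ i : Fin n, (u k r i : ℝ) * η i)}) with hE
  have hnR : (1:ℝ) ≤ n := by exact_mod_cast hn
  -- reduction to a single exponent
  suffices H : ∀ s : NNReal, 0 < s → (s:ℝ) < n →
      MeasureTheory.Measure.hausdorffMeasure (s:ℝ) E ≠ 0 by
    refine le_of_forall_lt fun d hd => ?_
    obtain ⟨s, hs1, hs2⟩ := ENNReal.lt_iff_exists_nnreal_btwn.mp hd
    have hs0 : 0 < s := by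
      have : (0:ℝ≥0∞) < s := lt_of_le_of_lt zero_le hs1
      exact_mod_cast this
    refine lt_of_lt_of_le hs1 (le_dimH_of_hausdorffMeasure_ne_zero (H s hs0 ?_))
    have : s < (n : NNReal) := by exact_mod_cast hs2
    exact_mod_cast this
  intro s hs0 hsn hzero
  have hs0' : (0:ℝ) < s := by exact_mod_cast hs0
  obtain ⟨b, hb2, hb8, hbs⟩ := lb_exists_base n hsn
  have hb0 : 0 < b := by omega
  have hbR : (1:ℝ) < b := by exact_mod_cast hb2
  set q : ℝ≥0∞ := (b:ℝ≥0∞)^(s:ℝ) with hq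
  have hbE0 : (b:ℝ≥0∞) ≠ 0 := by exact_mod_cast hb0.ne'
  have hq0 : q ≠ 0 := (ENNReal.rpow_pos (pos_iff_ne_zero.mpr hbE0) (by simp)).ne'
  have hqt : q ≠ ∞ := ENNReal.rpow_ne_top_of_nonneg hs0'.le (by simp)
  have hquart : (4⁻¹ : ℝ≥0∞) = 2⁻¹ * 2⁻¹ := by
    rw [← ENNReal.mul_inv (by simp) (by simp)]; norm_num
  have hhalf : (4⁻¹ : ℝ≥0∞) + 4⁻¹ = 2⁻¹ := by
    rw [hquart, ← mul_add, ENNReal.inv_two_add_inv_two, mul_one]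
  -- the cover
  obtain ⟨U, hUE, hU1, hUsum⟩ : ∃ U : ℕ → Set (Fin n → ℝ), E ⊆ ⋃ i, U i ∧
      (∀ i, Metric.ediam (U i) ≤ 1) ∧ ∑' i, Metric.ediam (U i) ^ (s:ℝ) ≤ q⁻¹ * 4⁻¹ := by
    rw [MeasureTheory.Measure.hausdorffMeasure_apply] at hzero
    simp only [ENNReal.iSup_eq_zero] at hzero
    have h1 := hzero 1 one_pos
    have h2 : (0:ℝ≥0∞) < q⁻¹ * 4⁻¹ := by
      apply ENNReal.mul_pos
      · simpa using hqt
      · simp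
    rw [← h1] at h2
    simp only [iInf_lt_iff] at h2
    obtain ⟨U, hUE, hU1, hlt⟩ := h2
    refine ⟨U, hUE, hU1, le_trans (ENNReal.tsum_le_tsum fun i => ?_) hlt.le⟩
    rcases (U i).eq_empty_or_nonempty with h | h
    · rw [h]; simp [hs0]
    · exact le_iSup (fun _ : (U i).Nonempty => Metric.ediam (U i) ^ (s:ℝ)) h
  obtain ⟨ε, hε0, hεsum⟩ := ENNReal.exists_pos_sum_of_countable (ε := 4⁻¹) (by simp) ℕ
  have hεE : ∀ i, (0:ℝ≥0∞) < ε i := fun i => by exact_mod_cast hε0 i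
  choose l hl1 hl2 using fun i => lb_exists_lvl hb2 hs0' (Metric.ediam (U i)) (ε i) (hU1 i) (hεE i)
  -- the lacunary data
  choose L hL using fun k => pow_unbounded_of_one_lt (b:ℝ) (hM k)
  choose j hj using fun k => lb_exists_depth (L k) (ε k) (hεE k)
  have ht1 : ∀ k r, 1 ≤ t k r := by
    intro k r
    obtain ⟨i, hi⟩ := Function.ne_iff.mp (hu k r)
    have h1 : (1:ℝ) ≤ (u k r i : ℝ)^2 := by
      have : 1 ≤ (u k r i)^2 := by
        have := sq_pos_of_ne_zero hi
        omega
      exact_mod_cast this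
    have h2 : (u k r i : ℝ)^2 ≤ (t k r)^2 := by
      rw [hnorm]
      exact Finset.single_le_sum (f := fun i => (u k r i : ℝ)^2) (fun _ _ => sq_nonneg _)
        (Finset.mem_univ i)
    nlinarith [ht k r]
  have hlev : ∀ k r, ∃ a : ℕ, 1 ≤ a ∧ 2 * n * t k r ≤ (b:ℝ)^a ∧
      (b:ℝ)^a ≤ b * (2 * n * t k r) := by
    intro k r
    have h1 : 1 ≤ 2 * n * t k r := by nlinarith [ht1 k r]
    obtain ⟨p, hp1, hp2⟩ := exists_nat_pow_near h1 hbR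
    refine ⟨p+1, by omega, hp2.le, ?_⟩
    rw [pow_succ, mul_comm]
    gcongr
  choose a ha1 ha2 ha3 using hlev
  -- obstacles
  let O : (ℕ × ℕ) ⊕ ℕ → Set (Fin n → ℝ) := Sum.elim
    (fun p => {η | dnint (∑ i, (u p.1 p.2 i : ℝ) * η i) < ((b:ℝ)⁻¹)^(j p.1) / (4 * n^2 * b)}) U
  let W : (ℕ × ℕ) ⊕ ℕ → ℕ → ℝ≥0∞ := Sum.elim
    (fun p m => if a p.1 p.2 ≤ m ∧ m ≤ a p.1 p.2 + j p.1 then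
      (4⁻¹)^(a p.1 p.2 + j p.1 - m) else 0)
    (fun i m => if m ≤ l i then (q⁻¹)^(l i - m) else 0)
  let N : (ℕ × ℕ) ⊕ ℕ → ℕ → ℝ≥0∞ := Sum.elim
    (fun p m => if a p.1 p.2 = m then (4⁻¹)^(j p.1) else 0) (fun _ _ => 0)
  suffices hcore : ∃ y, ∀ i, y ∉ O i by
    obtain ⟨y, hy⟩ := hcore
    have hyE : y ∈ E := by
      rw [hE, Set.mem_iInter]
      intro k
      refine ⟨((b:ℝ)⁻¹)^(j k) / (4 * n^2 * b), by positivity, fun r => ?_⟩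
      have := hy (Sum.inl (k, r))
      simpa [O] using this
    obtain ⟨i, hi⟩ := Set.mem_iUnion.mp (hUE hyE)
    exact hy (Sum.inr i) hi
  refine lb_core n b hb0 O W N ?_ ?_ ?_ ?_
  · rw [Summable.tsum_sum ENNReal.summable ENNReal.summable]
    have h1 : ∀ p : ℕ × ℕ, W (Sum.inl p) 0 = 0 := by
      intro p
      have := ha1 p.1 p.2
      simp only [W, Sum.elim_inl]
      rw [if_neg (by omega)]
    simp only [h1, tsum_zero, zero_add]
    calc ∑' i, W (Sum.inr i) 0 = ∑' i, (q⁻¹)^(l i) := by simp [W]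
      _ ≤ ∑' i, (q * Metric.ediam (U i) ^ (s:ℝ) + ε i) := ENNReal.tsum_le_tsum hl2
      _ = q * ∑' i, Metric.ediam (U i) ^ (s:ℝ) + ∑' i, (ε i : ℝ≥0∞) := by
          rw [ENNReal.tsum_add, ENNReal.tsum_mul_left]
      _ ≤ q * (q⁻¹ * 4⁻¹) + 4⁻¹ := by gcongr
      _ = 2⁻¹ := by rw [← mul_assoc, ENNReal.mul_inv_cancel hq0 hqt, one_mul, hhalf]
  · intro m
    rw [Summable.tsum_sum ENNReal.summable ENNReal.summable]
    simp only [N, Sum.elim_inl, Sum.elim_inr, tsum_zero, add_zero]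
    rw [ENNReal.tsum_prod']
    calc _ ≤ ∑' k, (ε k : ℝ≥0∞) := by
          refine ENNReal.tsum_le_tsum fun k => ?_
          exact (lb_count_lvl hn (M k) (hM k) (t k) (ht k) (hlac k) (a k) (L k) (hL k) (ha2 k)
            (ha3 k) m _).trans (hj k)
      _ ≤ _ := hεsum.le
  · rintro (⟨k, r⟩ | i) m
    · simp only [W, N, Sum.elim_inl]
      by_cases h : a k r ≤ m + 1 ∧ m + 1 ≤ a k r + j k
      · rcases eq_or_lt_of_le h.1 with h1 | h1
        · left
          rw [if_pos h, if_pos h1, ← h1, Nat.add_sub_cancel_left]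
        · right
          intro x
          have h2 : a k r ≤ m := by omega
          rw [if_pos h, if_pos ⟨h2, by omega⟩]
          have h3 := lb_slab_bound hn hb8 (u k r) (t k r) (ht k r) (hnorm k r) (a k r) (j k) m
            (ha2 k r) (ha3 k r) h2 h.2 x
          exact lb_arith (by omega) (lb_four h3)
      · left
        rw [if_neg h]
        exact zero_le
    · simp only [W, N, Sum.elim_inr]
      by_cases h : m + 1 ≤ l i
      · right
        intro x
        rw [if_pos h, if_pos (by omega)]
        have h3 := lb_count_set (b := b) x (((b:ℝ)⁻¹)^(m+1)) (by positivity) (U i)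
          ((hl1 i).trans (ENNReal.ofReal_le_ofReal (pow_le_pow_of_le_one (by positivity)
            (inv_le_one_of_one_le₀ hbR.le) h)))
        exact lb_arith (by omega) (lb_five h3 hq0 hqt hbs)
      · left
        rw [if_neg h]
  · rintro (⟨k, r⟩ | i)
    · refine ⟨a k r + j k, ?_⟩
      simp [W]
    · refine ⟨l i, ?_⟩
      simp [W]
end

section
/- Let m, n be positive integers and let Θ = (θ_{i,j}) be an m×n real matrix. Then there exists a sequence (u^{(r)})_{r≥1} of nonzero integer vectors u^{(r)} ∈ ℤ^n whose Euclidean norms t_r = |u^{(r)}| satisfy t_{r+1} ≥ 3 t_r for all r ≥ 1, such that every η = (η_1,…,η_n) ∈ ℝ^n with inf_{r≥1} ‖u_1^{(r)} η_1 + ⋯ + u_n^{(r)} η_n‖ > 0 satisfies inf over x ∈ ℤ^m \ {0} of (max_{1≤j≤n} ‖L_j(x) − η_j‖)^n · (max_{1≤i≤m} |x_i|)^m > 0. -/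
lemma dnint_bdd (t : ℝ) : BddBelow (Set.range fun k : ℤ => |t - (k : ℝ)|) :=
  ⟨0, by rintro _ ⟨k, rfl⟩; positivity⟩

lemma dnint_le (t : ℝ) (k : ℤ) : dnint t ≤ |t - k| := ciInf_le (dnint_bdd t) k

lemma dnint_eq (t : ℝ) : dnint t = |t - round t| :=
  le_antisymm (dnint_le t _) (le_ciInf fun k => round_le t k)

lemma dnint_nonneg (t : ℝ) : 0 ≤ dnint t := by rw [dnint_eq]; positivity

lemma dnint_le_one (t : ℝ) : dnint t ≤ 1 := by
  rw [dnint_eq]; have := abs_sub_round t; linarith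

lemma dnint_zero : dnint 0 = 0 := by rw [dnint_eq]; simp

lemma dnint_add_le (s t : ℝ) : dnint (s + t) ≤ dnint s + dnint t := by
  rw [dnint_eq s, dnint_eq t]
  refine (dnint_le _ (round s + round t)).trans ?_
  push_cast
  calc |s + t - (round s + round t)| = |(s - round s) + (t - round t)| := by ring_nf
    _ ≤ _ := abs_add_le _ _

lemma dnint_int_mul_le (a : ℤ) (t : ℝ) : dnint (a * t) ≤ |(a : ℝ)| * dnint t := by
  rw [dnint_eq t, ← abs_mul]
  refine (dnint_le _ (a * round t)).trans ?_
  push_cast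
  rw [mul_sub]

lemma dnint_sum_le {k : ℕ} (f : Fin k → ℝ) : dnint (∑ i, f i) ≤ ∑ i, dnint (f i) := by
  refine Finset.le_sum_of_subadditive dnint dnint_zero.le (fun a b => ?_) _ _
  exact dnint_add_le a b

/-- Euclidean norm of an integer vector. -/
noncomputable def enorm2 {n : ℕ} (u : Fin n → ℤ) : ℝ := Real.sqrt (∑ i, ((u i : ℝ)) ^ 2)

/-- Value of the dual system. -/
noncomputable def zet {m n : ℕ} (θ : Fin m → Fin n → ℝ) (u : Fin n → ℤ) : ℝ :=
  ⨆ i, dnint (∑ j, θ i j * (u j : ℝ))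

lemma dnint_le_zet {m n : ℕ} (θ : Fin m → Fin n → ℝ) (u : Fin n → ℤ) (i : Fin m) :
    dnint (∑ j, θ i j * (u j : ℝ)) ≤ zet θ u :=
  le_ciSup (f := fun i => dnint (∑ j, θ i j * (u j : ℝ))) (Set.finite_range _).bddAbove i

lemma zet_nonneg {m n : ℕ} (θ : Fin m → Fin n → ℝ) (u : Fin n → ℤ) : 0 ≤ zet θ u :=
  Real.iSup_nonneg fun _ => dnint_nonneg _

lemma zet_le {m n : ℕ} (θ : Fin m → Fin n → ℝ) (u : Fin n → ℤ) {c : ℝ} (hc : 0 ≤ c)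
    (h : ∀ i, dnint (∑ j, θ i j * (u j : ℝ)) ≤ c) : zet θ u ≤ c :=
  Real.iSup_le h hc

lemma abs_le_enorm2 {n : ℕ} (u : Fin n → ℤ) (j : Fin n) : |(u j : ℝ)| ≤ enorm2 u := by
  apply Real.abs_le_sqrt
  exact Finset.single_le_sum (f := fun i => ((u i : ℝ)) ^ 2) (fun i _ => sq_nonneg _) (Finset.mem_univ j)

lemma one_le_enorm2 {n : ℕ} (u : Fin n → ℤ) (hu : u ≠ 0) : 1 ≤ enorm2 u := by
  obtain ⟨j, hj⟩ := Function.ne_iff.1 hu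
  refine le_trans ?_ (abs_le_enorm2 u j)
  have : 1 ≤ |u j| := Int.one_le_abs hj
  exact_mod_cast this

lemma enorm2_le {n : ℕ} (u : Fin n → ℤ) (N : ℝ) (hN : 0 ≤ N) (h : ∀ j, |(u j : ℝ)| ≤ N) :
    enorm2 u ≤ n * N := by
  apply Real.sqrt_le_iff.2 ⟨by positivity, ?_⟩
  calc ∑ i, ((u i : ℝ)) ^ 2 ≤ ∑ i : Fin n, N ^ 2 := by
        apply Finset.sum_le_sum
        intro i _
        exact sq_le_sq' (abs_le.1 (h i)).1 (abs_le.1 (h i)).2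
    _ = n * N ^ 2 := by simp
    _ ≤ (n * N) ^ 2 := by
        rw [mul_pow]
        gcongr
        exact_mod_cast Nat.le_self_pow two_ne_zero n

lemma enorm2_three {n : ℕ} (u : Fin n → ℤ) : enorm2 (fun j => 3 * u j) = 3 * enorm2 u := by
  unfold enorm2
  push_cast
  simp_rw [mul_pow]
  rw [← Finset.mul_sum, Real.sqrt_mul (by positivity), Real.sqrt_sq (by norm_num)]

lemma zet_three {m n : ℕ} (θ : Fin m → Fin n → ℝ) (u : Fin n → ℤ) :
    zet θ (fun j => 3 * u j) ≤ 3 * zet θ u := by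
  apply zet_le _ _ (by have := zet_nonneg θ u; positivity)
  intro i
  have e : ∑ j, θ i j * ((3 * u j : ℤ) : ℝ) = ((3 : ℤ) : ℝ) * ∑ j, θ i j * (u j : ℝ) := by
    rw [Finset.mul_sum]; push_cast; exact Finset.sum_congr rfl fun j _ => by ring
  rw [e]
  refine (dnint_int_mul_le _ _).trans ?_
  have := dnint_le_zet θ u i
  norm_num
  exact this

lemma exists_H (m A : ℕ) (hm : 0 < m) (hA : 0 < A) :
    ∃ H : ℕ, 1 ≤ H ∧ H ^ m ≤ A ∧ A < (H + 1) ^ m := by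
  have h1 : (fun h => h ^ m ≤ A) 1 := by simpa using Nat.succ_le_of_lt hA
  refine ⟨Nat.findGreatest (fun h => h ^ m ≤ A) A, Nat.le_findGreatest hA h1,
    Nat.findGreatest_spec (P := fun h => h ^ m ≤ A) hA h1, ?_⟩
  by_contra hcon
  push Not at hcon
  have := Nat.le_findGreatest (P := fun h => h ^ m ≤ A)
    ((Nat.le_self_pow hm.ne' _).trans hcon) hcon
  omega

lemma pigeon (m n : ℕ) (hm : 0 < m) (hn : 0 < n) (θ : Fin m → Fin n → ℝ) (N : ℕ) (hN : 0 < N) :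
    ∃ u : Fin n → ℤ, u ≠ 0 ∧ (∀ j, |(u j : ℝ)| ≤ N) ∧ zet θ u ^ m * (N : ℝ) ^ n ≤ 2 ^ m := by
  obtain ⟨H, hH1, hH2, hH3⟩ := exists_H m (N ^ n) hm (by positivity)
  have hHpos : (0 : ℝ) < H := by exact_mod_cast hH1
  let M : (Fin n → Fin (N + 1)) → Fin m → ℝ := fun v i => ∑ j, θ i j * ((v j : ℕ) : ℝ)
  let f : (Fin n → Fin (N + 1)) → (Fin m → Fin H) := fun v i =>
    ⟨⌊(H : ℝ) * Int.fract (M v i)⌋₊, by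
      rw [Nat.floor_lt (by positivity)]
      have := Int.fract_lt_one (M v i)
      nlinarith⟩
  obtain ⟨v, w, hvw, hf⟩ := Fintype.exists_ne_map_eq_of_card_lt f (by
    simp only [Fintype.card_fun, Fintype.card_fin]
    exact hH2.trans_lt (Nat.pow_lt_pow_left (by omega) hn.ne'))
  refine ⟨fun j => ((v j : ℕ) : ℤ) - ((w j : ℕ) : ℤ), ?_, ?_, ?_⟩
  · intro h
    apply hvw
    funext j
    have := congrFun h j
    simp only [Pi.zero_apply] at this
    apply Fin.ext
    omega
  · intro j
    have h1 := (v j).2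
    have h2 := (w j).2
    have : |((v j : ℕ) : ℤ) - ((w j : ℕ) : ℤ)| ≤ N := by
      rw [abs_le]; omega
    exact_mod_cast this
  · have hz : zet θ (fun j => ((v j : ℕ) : ℤ) - ((w j : ℕ) : ℤ)) ≤ 1 / H := by
      apply zet_le _ _ (by positivity)
      intro i
      have e : ∑ j, θ i j * (((((v j : ℕ) : ℤ) - ((w j : ℕ) : ℤ)) : ℤ) : ℝ) = M v i - M w i := by
        simp only [M]
        rw [← Finset.sum_sub_distrib]
        push_cast
        exact Finset.sum_congr rfl fun j _ => by ring
      rw [e]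
      refine (dnint_le _ (⌊M v i⌋ - ⌊M w i⌋)).trans ?_
      have hfi : ⌊(H : ℝ) * Int.fract (M v i)⌋₊ = ⌊(H : ℝ) * Int.fract (M w i)⌋₊ :=
        congrArg Fin.val (congrFun hf i)
      have a1 := Nat.floor_le (show 0 ≤ (H : ℝ) * Int.fract (M v i) by positivity)
      have a2 := Nat.lt_floor_add_one ((H : ℝ) * Int.fract (M v i))
      have b1 := Nat.floor_le (show 0 ≤ (H : ℝ) * Int.fract (M w i) by positivity)
      have b2 := Nat.lt_floor_add_one ((H : ℝ) * Int.fract (M w i))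
      rw [hfi] at a1 a2
      have e2 : M v i - M w i - ((⌊M v i⌋ - ⌊M w i⌋ : ℤ) : ℝ)
          = Int.fract (M v i) - Int.fract (M w i) := by
        unfold Int.fract; push_cast; ring
      rw [e2, le_div_iff₀ hHpos, ← abs_of_pos hHpos, ← abs_mul, abs_le]
      constructor <;> nlinarith
    have hN2 : (N : ℝ) ^ n ≤ (2 * H) ^ m := by
      have : N ^ n ≤ (2 * H) ^ m := hH3.le.trans (Nat.pow_le_pow_left (by omega) m)
      exact_mod_cast this
    calc _ ≤ (1 / (H : ℝ)) ^ m * (2 * H) ^ m := by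
          gcongr
          exact zet_nonneg _ _
      _ = 2 ^ m := by
          rw [← mul_pow]; congr 1; field_simp

lemma zet_le_one {m n : ℕ} (θ : Fin m → Fin n → ℝ) (u : Fin n → ℤ) : zet θ u ≤ 1 :=
  zet_le _ _ zero_le_one fun _ => dnint_le_one _

lemma exists_unit (n : ℕ) (hn : 0 < n) : ∃ u : Fin n → ℤ, u ≠ 0 ∧ enorm2 u ≤ 1 := by
  refine ⟨Pi.single ⟨0, hn⟩ 1, ?_, ?_⟩
  · simp
  · unfold enorm2
    rw [Real.sqrt_le_one]
    rw [Finset.sum_eq_single ⟨0, hn⟩]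
    · simp
    · intro b _ hb; simp [Pi.single_apply, hb]
    · simp

lemma minkowski (m n : ℕ) (hm : 0 < m) (hn : 0 < n) (θ : Fin m → Fin n → ℝ) (Q : ℝ) (hQ : 1 ≤ Q) :
    ∃ u : Fin n → ℤ, u ≠ 0 ∧ enorm2 u ≤ Q ∧ zet θ u ^ m * Q ^ n ≤ 2 ^ m * (2 * n) ^ n := by
  have hn' : (0 : ℝ) < n := by exact_mod_cast hn
  have hn1 : (1 : ℝ) ≤ n := by exact_mod_cast hn
  rcases lt_or_ge Q n with h | h
  · obtain ⟨u, hu, hu1⟩ := exists_unit n hn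
    refine ⟨u, hu, hu1.trans hQ, ?_⟩
    have h1 : zet θ u ^ m ≤ 2 ^ m := by
      gcongr
      · exact zet_nonneg _ _
      · linarith [zet_le_one θ u]
    have h2 : Q ^ n ≤ (2 * n : ℝ) ^ n := by
      gcongr; linarith
    gcongr
  · have hq : 1 ≤ Q / n := (one_le_div hn').2 h
    have hN : 0 < ⌊Q / n⌋₊ := Nat.floor_pos.2 hq
    obtain ⟨u, hu, hu1, hu2⟩ := pigeon m n hm hn θ _ hN
    have hN1 : (1 : ℝ) ≤ ⌊Q / n⌋₊ := by exact_mod_cast hN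
    have f1 := Nat.floor_le (show 0 ≤ Q / n by positivity)
    have f2 := Nat.lt_floor_add_one (Q / n)
    refine ⟨u, hu, ?_, ?_⟩
    · refine (enorm2_le u _ (by positivity) hu1).trans ?_
      rw [le_div_iff₀ hn'] at f1
      linarith
    · have : Q ≤ (2 * n) * ⌊Q / n⌋₊ := by
        rw [div_lt_iff₀ hn'] at f2
        nlinarith
      calc zet θ u ^ m * Q ^ n ≤ zet θ u ^ m * ((2 * n) * ⌊Q / n⌋₊) ^ n := by
            gcongr
            exact pow_nonneg (zet_nonneg _ _) _
        _ = (zet θ u ^ m * (⌊Q / n⌋₊ : ℝ) ^ n) * (2 * n) ^ n := by rw [mul_pow]; ring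
        _ ≤ _ := by gcongr

lemma exists_min (m n : ℕ) (hn : 0 < n) (θ : Fin m → Fin n → ℝ) (Q : ℝ) (hQ : 1 ≤ Q) :
    ∃ u : Fin n → ℤ, u ≠ 0 ∧ enorm2 u ≤ Q ∧
      ∀ v : Fin n → ℤ, v ≠ 0 → enorm2 v ≤ Q → zet θ u ≤ zet θ v := by
  have hfin : {u : Fin n → ℤ | u ≠ 0 ∧ enorm2 u ≤ Q}.Finite := by
    refine (Set.finite_Icc (fun _ : Fin n => -⌈Q⌉) (fun _ => ⌈Q⌉)).subset ?_
    rintro u ⟨_, hu⟩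
    have key : ∀ j, |u j| ≤ ⌈Q⌉ := fun j => by
      have := ((abs_le_enorm2 u j).trans hu).trans (Int.le_ceil Q)
      exact_mod_cast this
    exact ⟨fun j => (abs_le.1 (key j)).1, fun j => (abs_le.1 (key j)).2⟩
  obtain ⟨u0, h0, h1⟩ := exists_unit n hn
  obtain ⟨u, hu, hmin⟩ := Set.exists_min_image _ (zet θ) hfin ⟨u0, h0, h1.trans hQ⟩
  exact ⟨u, hu.1, hu.2, fun v hv hv2 => hmin v ⟨hv, hv2⟩⟩

/-- Invariant of the recursion. -/
def RInv {m n : ℕ} (θ : Fin m → Fin n → ℝ) (K : ℝ) (u : Fin n → ℤ) : Prop :=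
  u ≠ 0 ∧ zet θ u ^ m * (9 * enorm2 u) ^ n ≤ K ∧
    ∀ v : Fin n → ℤ, v ≠ 0 → enorm2 v ≤ enorm2 u → zet θ u ≤ 3 * zet θ v

lemma inv_step (m n : ℕ) (hm : 0 < m) (hn : 0 < n) (θ : Fin m → Fin n → ℝ) (K : ℝ)
    (hK : 6 ^ m * 9 ^ n * (2 ^ m * (2 * n) ^ n) ≤ K) (u : Fin n → ℤ) (hu : RInv θ K u) :
    ∃ u' : Fin n → ℤ, RInv θ K u' ∧ 3 * enorm2 u ≤ enorm2 u' ∧ zet θ u' ≤ zet θ u / 2 ∧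
      zet θ u ^ m * enorm2 u' ^ n ≤ K := by
  obtain ⟨hu0, hua, hub⟩ := hu
  have hn' : (0 : ℝ) < n := by exact_mod_cast hn
  set c : ℝ := 2 ^ m * (2 * n) ^ n with hc
  have hcpos : 0 < c := by positivity
  have hKpos : 0 < K := lt_of_lt_of_le (by positivity) hK
  have ht1 := one_le_enorm2 u hu0
  rcases (zet_nonneg θ u).eq_or_lt with hz | hz
  · have h3 : zet θ (fun j => 3 * u j) = 0 :=
      le_antisymm ((zet_three θ u).trans (by rw [← hz]; simp)) (zet_nonneg _ _)
    refine ⟨fun j => 3 * u j, ⟨?_, ?_, ?_⟩, ?_, ?_, ?_⟩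
    · intro h
      apply hu0
      funext j
      have := congrFun h j
      simp only [Pi.zero_apply] at this
      simp only [Pi.zero_apply]
      omega
    · rw [h3, zero_pow hm.ne']; simpa using hKpos.le
    · intro v _ _; rw [h3]; have := zet_nonneg θ v; positivity
    · rw [enorm2_three]
    · rw [h3, ← hz]; simp
    · rw [← hz, zero_pow hm.ne']; simpa using hKpos.le
  · obtain ⟨Q, hQ0, hQ⟩ : ∃ Q : ℝ, 0 ≤ Q ∧ Q ^ n = K / zet θ u ^ m :=
      ⟨(K / zet θ u ^ m) ^ ((n : ℝ)⁻¹), by positivity, Real.rpow_inv_natCast_pow (by positivity) hn.ne'⟩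
    have hQK : zet θ u ^ m * Q ^ n = K := by rw [hQ]; field_simp
    have hQ9 : 9 * enorm2 u ≤ Q := by
      refine le_of_pow_le_pow_left₀ hn.ne' hQ0 ?_
      rw [hQ, le_div_iff₀ (by positivity)]
      linarith
    have hQ1 : 1 ≤ Q := by linarith
    obtain ⟨w, hw0, hwQ, hwmin⟩ := exists_min m n hn θ Q hQ1
    obtain ⟨w', hw'0, hw'Q, hw'⟩ := minkowski m n hm hn θ Q hQ1
    have hwz := zet_nonneg θ w
    have hwc : zet θ w ^ m * Q ^ n ≤ c := by
      refine le_trans ?_ hw'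
      have := hwmin w' hw'0 hw'Q
      gcongr
    have hQn : 0 < Q ^ n := by positivity
    have h6 : 6 * zet θ w ≤ zet θ u := by
      refine le_of_pow_le_pow_left₀ hm.ne' hz.le ?_
      refine le_of_mul_le_mul_right ?_ hQn
      rw [hQK, mul_pow]
      calc 6 ^ m * zet θ w ^ m * Q ^ n = 6 ^ m * (zet θ w ^ m * Q ^ n) := by ring
        _ ≤ 6 ^ m * c := by gcongr
        _ ≤ 6 ^ m * 9 ^ n * c := by
          gcongr
          exact le_mul_of_one_le_right (by positivity) (one_le_pow₀ (by norm_num))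
        _ ≤ K := hK
    have hwt : enorm2 u < enorm2 w := by
      by_contra hcon
      have := hub w hw0 (not_lt.1 hcon)
      linarith
    -- general finishing
    have fin : ∀ u' : Fin n → ℤ, u' ≠ 0 → enorm2 u' ≤ Q → 3 * enorm2 u ≤ enorm2 u' →
        zet θ u' ≤ 3 * zet θ w → ∃ u' : Fin n → ℤ, RInv θ K u' ∧ 3 * enorm2 u ≤ enorm2 u' ∧
          zet θ u' ≤ zet θ u / 2 ∧ zet θ u ^ m * enorm2 u' ^ n ≤ K := by
      intro u' h0 h1 h2 h3
      have hz' := zet_nonneg θ u'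
      have ht' : 0 ≤ enorm2 u' := by linarith
      refine ⟨u', ⟨h0, ?_, ?_⟩, h2, by linarith, ?_⟩
      · calc zet θ u' ^ m * (9 * enorm2 u') ^ n ≤ (6 * zet θ w) ^ m * (9 * Q) ^ n := by
              gcongr; linarith
          _ = 6 ^ m * 9 ^ n * (zet θ w ^ m * Q ^ n) := by rw [mul_pow, mul_pow]; ring
          _ ≤ 6 ^ m * 9 ^ n * c := by gcongr
          _ ≤ K := hK
      · intro v hv hvt
        have := hwmin v hv (hvt.trans h1)
        linarith
      · rw [← hQK]; gcongr
    rcases le_or_gt (3 * enorm2 u) (enorm2 w) with h | h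
    · exact fin w hw0 hwQ h (by linarith)
    · refine fin (fun j => 3 * w j) ?_ ?_ ?_ (zet_three θ w)
      · intro h
        apply hw0
        funext j
        have := congrFun h j
        simp only [Pi.zero_apply] at this
        simp only [Pi.zero_apply]
        omega
      · rw [enorm2_three]; linarith
      · rw [enorm2_three]; linarith

lemma exists_seq (m n : ℕ) (hm : 0 < m) (hn : 0 < n) (θ : Fin m → Fin n → ℝ) :
    ∃ (K : ℝ) (u : ℕ → Fin n → ℤ), 0 < K ∧ (∀ r, u r ≠ 0) ∧
      (∀ r, 3 * enorm2 (u r) ≤ enorm2 (u (r + 1))) ∧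
      (∀ r, zet θ (u (r + 1)) ≤ zet θ (u r) / 2) ∧
      (∀ r, zet θ (u r) ^ m * enorm2 (u (r + 1)) ^ n ≤ K) := by
  have hn' : (0 : ℝ) < n := by exact_mod_cast hn
  set K : ℝ := 6 ^ m * 9 ^ n * (2 ^ m * (2 * n) ^ n) + 9 ^ n with hKdef
  have hKpos : 0 < K := by positivity
  have hK1 : 6 ^ m * 9 ^ n * (2 ^ m * (2 * n) ^ n) ≤ K := by
    have : (0 : ℝ) ≤ 9 ^ n := by positivity
    linarith
  have hK2 : (9 : ℝ) ^ n ≤ K := by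
    have : (0 : ℝ) ≤ 6 ^ m * 9 ^ n * (2 ^ m * (2 * n) ^ n) := by positivity
    linarith
  obtain ⟨u0, h0, h1, h2⟩ := exists_min m n hn θ 1 le_rfl
  have hI0 : RInv θ K u0 := by
    refine ⟨h0, ?_, ?_⟩
    · have a := zet_nonneg θ u0
      have b := one_le_enorm2 u0 h0
      calc zet θ u0 ^ m * (9 * enorm2 u0) ^ n ≤ 1 ^ m * (9 * 1) ^ n := by
            gcongr; exact zet_le_one _ _
        _ ≤ K := by simpa using hK2
    · intro v hv hvt
      have := h2 v hv (hvt.trans h1)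
      have := zet_nonneg θ v
      linarith
  choose g hg using fun p : {u : Fin n → ℤ // RInv θ K u} => inv_step m n hm hn θ K hK1 p.1 p.2
  let s : ℕ → {u : Fin n → ℤ // RInv θ K u} := fun r =>
    Nat.rec ⟨u0, hI0⟩ (fun _ p => ⟨g p, (hg p).1⟩) r
  exact ⟨K, fun r => (s r).1, hKpos, fun r => (s r).2.1, fun r => (hg (s r)).2.1,
    fun r => (hg (s r)).2.2.1, fun r => (hg (s r)).2.2.2⟩

lemma key_ineq {m n : ℕ} (θ : Fin m → Fin n → ℝ) (u : Fin n → ℤ) (η : Fin n → ℝ)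
    (x : Fin m → ℤ) (δ X : ℝ)
    (hδ : ∀ j, dnint ((∑ i : Fin m, θ i j * (x i : ℝ)) - η j) ≤ δ)
    (hX : ∀ i, |(x i : ℝ)| ≤ X) :
    dnint (∑ j, (u j : ℝ) * η j) ≤ n * enorm2 u * δ + m * X * zet θ u := by
  have e : ∑ j, (u j : ℝ) * η j =
      ∑ j, ((-u j : ℤ) : ℝ) * ((∑ i : Fin m, θ i j * (x i : ℝ)) - η j) +
      ∑ i, (x i : ℝ) * ∑ j, θ i j * (u j : ℝ) := by
    have : ∑ i, (x i : ℝ) * ∑ j, θ i j * (u j : ℝ)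
        = ∑ j, (u j : ℝ) * ∑ i : Fin m, θ i j * (x i : ℝ) := by
      simp_rw [Finset.mul_sum]
      rw [Finset.sum_comm]
      exact Finset.sum_congr rfl fun j _ => Finset.sum_congr rfl fun i _ => by ring
    rw [this, ← Finset.sum_add_distrib]
    push_cast
    exact Finset.sum_congr rfl fun j _ => by ring
  rw [e]
  refine (dnint_add_le _ _).trans (add_le_add ?_ ?_)
  · refine (dnint_sum_le _).trans ?_
    calc _ ≤ ∑ j : Fin n, enorm2 u * δ := by
          refine Finset.sum_le_sum fun j _ => (dnint_int_mul_le _ _).trans ?_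
          refine mul_le_mul ?_ (hδ j) (dnint_nonneg _) (Real.sqrt_nonneg _)
          push_cast
          rw [abs_neg]
          exact abs_le_enorm2 u j
      _ = _ := by simp; ring
  · refine (dnint_sum_le _).trans ?_
    calc _ ≤ ∑ i : Fin m, X * zet θ u := by
          refine Finset.sum_le_sum fun i _ => (dnint_int_mul_le _ _).trans ?_
          exact mul_le_mul (hX i) (dnint_le_zet θ u i) (dnint_nonneg _)
            ((abs_nonneg _).trans (hX i))
      _ = _ := by simp; ring

/-- The transference step: for any `Θ` there is a sequence of nonzero integer
vectors `u⁽ʳ⁾` with Euclidean norms `t_r` satisfying `t_{r+1} ≥ 3 t_r`, such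
that any `η` with `inf_r ‖u⁽ʳ⁾ · η‖ > 0` is badly approximable for the
inhomogeneous forms `L_j(x) - η_j`. -/
theorem transference_step (m n : ℕ) (hm : 0 < m) (hn : 0 < n)
    (θ : Fin m → Fin n → ℝ) :
    ∃ u : ℕ → Fin n → ℤ,
      (∀ r, u r ≠ 0) ∧
      (∀ r, 3 * Real.sqrt (∑ i : Fin n, ((u r i : ℝ)) ^ 2) ≤
          Real.sqrt (∑ i : Fin n, ((u (r + 1) i : ℝ)) ^ 2)) ∧
      ∀ η : Fin n → ℝ,
        (0 < ⨅ r : ℕ, dnint (∑ i : Fin n, (u r i : ℝ) * η i)) →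
        0 < ⨅ x : {x : Fin m → ℤ // x ≠ 0},
            (⨆ j : Fin n, dnint ((∑ i : Fin m, θ i j * (x.val i : ℝ)) - η j)) ^ n *
              (⨆ i : Fin m, (|x.val i| : ℝ)) ^ m := by
  obtain ⟨K, u, hK, hu0, hu3, huz, huK⟩ := exists_seq m n hm hn θ
  refine ⟨u, hu0, hu3, fun η hη => ?_⟩
  set ε := ⨅ r : ℕ, dnint (∑ i : Fin n, (u r i : ℝ) * η i) with hε
  have hεr : ∀ r, ε ≤ dnint (∑ i : Fin n, (u r i : ℝ) * η i) := fun r =>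
    ciInf_le (f := fun r => dnint (∑ i : Fin n, (u r i : ℝ) * η i))
      ⟨0, by rintro _ ⟨k, rfl⟩; exact dnint_nonneg _⟩ r
  have hn' : (0 : ℝ) < n := by exact_mod_cast hn
  have hm' : (0 : ℝ) < m := by exact_mod_cast hm
  have ht : ∀ r, 0 < enorm2 (u r) := fun r => lt_of_lt_of_le one_pos (one_le_enorm2 _ (hu0 r))
  have hzr : ∀ r, zet θ (u r) ≤ (1 / 2) ^ r := by
    intro r
    induction r with
    | zero => simpa using zet_le_one θ (u 0)
    | succ k ih => rw [pow_succ]; linarith [huz k]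
  haveI : Nonempty {x : Fin m → ℤ // x ≠ 0} := by
    obtain ⟨v, hv, _⟩ := exists_unit m hm
    exact ⟨⟨v, hv⟩⟩
  set c1 : ℝ := (ε / (2 * n * enorm2 (u 0))) ^ n with hc1
  set c2 : ℝ := (ε / (2 * n)) ^ n * (ε / (2 * m)) ^ m / K with hc2
  have hc1p : 0 < c1 := by have := ht 0; positivity
  have hc2p : 0 < c2 := by positivity
  refine lt_of_lt_of_le (lt_min hc1p hc2p) (le_ciInf fun x => ?_)
  obtain ⟨x, hx⟩ := x
  simp only
  set δ := ⨆ j : Fin n, dnint ((∑ i : Fin m, θ i j * (x i : ℝ)) - η j) with hδ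
  set X := ⨆ i : Fin m, (|(x i : ℝ)|) with hX
  have hδj : ∀ j, dnint ((∑ i : Fin m, θ i j * (x i : ℝ)) - η j) ≤ δ := fun j =>
    le_ciSup (f := fun j => dnint ((∑ i : Fin m, θ i j * (x i : ℝ)) - η j))
      (Set.finite_range _).bddAbove j
  have hXi : ∀ i, |(x i : ℝ)| ≤ X := fun i =>
    le_ciSup (f := fun i => |(x i : ℝ)|) (Set.finite_range _).bddAbove i
  have hX1 : 1 ≤ X := by
    obtain ⟨j, hj⟩ := Function.ne_iff.1 hx
    refine le_trans ?_ (hXi j)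
    have : 1 ≤ |x j| := Int.one_le_abs hj
    exact_mod_cast this
  have hex : ∃ r, m * X * zet θ (u r) ≤ ε / 2 := by
    obtain ⟨r, hr⟩ := exists_pow_lt_of_lt_one (show 0 < ε / 2 / (m * X) by positivity)
      (show (1 / 2 : ℝ) < 1 by norm_num)
    refine ⟨r, ?_⟩
    have := (hzr r).trans hr.le
    rw [le_div_iff₀ (by positivity)] at this
    linarith
  classical
  have hspec := Nat.find_spec hex
  have hmin := fun s => Nat.find_min (H := hex) (m := s)
  generalize Nat.find hex = r at hspec hmin
  have hmain : ε / (2 * n * enorm2 (u r)) ≤ δ := by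
    have h1 := (hεr r).trans (key_ineq θ (u r) η x δ X hδj hXi)
    have := ht r
    rw [div_le_iff₀ (by positivity)]
    linarith
  cases r with
  | zero =>
    refine (min_le_left _ _).trans ?_
    have := ht 0
    calc c1 ≤ δ ^ n := by rw [hc1]; gcongr
      _ ≤ δ ^ n * X ^ m := le_mul_of_one_le_right
          (pow_nonneg (le_trans (by positivity) hmain) _) (one_le_pow₀ hX1)
  | succ s =>
    refine (min_le_right _ _).trans ?_
    have htp := ht (s + 1)
    have h1 := hmin s (Nat.lt_succ_self s)
    push Not at h1
    have h2 : ε / (2 * m) ≤ X * zet θ (u s) := by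
      rw [div_le_iff₀ (by positivity)]; linarith
    have h3 : (ε / (2 * m)) ^ m * enorm2 (u (s + 1)) ^ n ≤ X ^ m * K := by
      calc _ ≤ (X * zet θ (u s)) ^ m * enorm2 (u (s + 1)) ^ n := by gcongr
        _ = X ^ m * (zet θ (u s) ^ m * enorm2 (u (s + 1)) ^ n) := by rw [mul_pow]; ring
        _ ≤ _ := by have := huK s; gcongr
    have h4 : (ε / (2 * n)) ^ n ≤ δ ^ n * enorm2 (u (s + 1)) ^ n := by
      rw [← mul_pow]
      have : ε / (2 * n) ≤ δ * enorm2 (u (s + 1)) := by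
        rw [div_le_iff₀ (by positivity)] at hmain ⊢
        linarith
      gcongr
    have hδ0 : 0 ≤ δ := le_trans (by positivity) hmain
    rw [hc2, div_le_iff₀ hK]
    refine le_of_mul_le_mul_right ?_ (show 0 < enorm2 (u (s + 1)) ^ n by positivity)
    calc _ = (ε / (2 * n)) ^ n * ((ε / (2 * m)) ^ m * enorm2 (u (s + 1)) ^ n) := by ring
      _ ≤ (δ ^ n * enorm2 (u (s + 1)) ^ n) * (X ^ m * K) := by gcongr
      _ = _ := by ring
end

section
/- For any real number θ, the set 𝓑 of real numbers η such that inf over x ∈ ℤ \ {0} of |x| · ‖θx + η‖ > 0 has full Hausdorff dimension in ℝ, i.e. its Hausdorff dimension equals 1. -/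
open Set in
/-- Left endpoints of the intervals of the Cantor construction. -/
noncomputable def cantorLeft (M : ℕ) (R : ℝ) (φ : ℕ → ℝ → Fin M → ℕ) (d : ℕ → Fin M) : ℕ → ℝ
  | 0 => 0
  | n + 1 => cantorLeft M R φ d n +
      2 * (φ n (cantorLeft M R φ d n) (d n) : ℝ) * (R ^ (n + 1))⁻¹

open Set in
theorem cantor_dim (k : ℕ) (hk : 1 ≤ k) (S : Set ℝ) (Good : ℕ → ℝ → Prop)
    (H : ∀ (n : ℕ) (a : ℝ), ∃ φ : Fin (4 ^ k) → ℕ, Function.Injective φ ∧ ∀ j, φ j < 2 * 4 ^ k ∧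
      ∀ η : ℝ, a + 2 * (φ j : ℝ) * (((4 : ℝ) ^ (k + 1)) ^ (n + 1))⁻¹ ≤ η →
        η ≤ a + 2 * (φ j : ℝ) * (((4 : ℝ) ^ (k + 1)) ^ (n + 1))⁻¹
          + (((4 : ℝ) ^ (k + 1)) ^ (n + 1))⁻¹ → Good n η)
    (hS : ∀ η, (∀ n, Good n η) → η ∈ S) :
    (((k : NNReal) / (k + 1) : NNReal) : ENNReal) ≤ dimH S := by
  choose φ hinj hφ using H
  set R : ℝ := (4 : ℝ) ^ (k + 1) with hR
  have hR0 : 0 < R := by positivity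
  have hRM : R = 4 * ((4 ^ k : ℕ) : ℝ) := by push_cast; rw [hR]; ring
  set A := cantorLeft (4 ^ k) R φ with hA
  have hsucc : ∀ d n, A d (n + 1) = A d n + 2 * (φ n (A d n) (d n) : ℝ) * (R ^ (n + 1))⁻¹ :=
    fun d n => rfl
  have hpow : ∀ n : ℕ, (R ^ n)⁻¹ = R * (R ^ (n + 1))⁻¹ := by
    intro n; rw [pow_succ]; field_simp
  have hmono : ∀ d, Monotone (A d) := by
    intro d
    refine monotone_nat_of_le_succ fun n => ?_
    rw [hsucc]
    have : 0 ≤ 2 * (φ n (A d n) (d n) : ℝ) * (R ^ (n + 1))⁻¹ := by positivity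
    linarith
  have hanti : ∀ d, Antitone (fun n => A d n + (R ^ n)⁻¹) := by
    intro d
    refine antitone_nat_of_succ_le fun n => ?_
    rw [hsucc, hpow n]
    have h1 : (φ n (A d n) (d n)) + 1 ≤ 2 * 4 ^ k := (hφ n (A d n) (d n)).1
    have h2 : (φ n (A d n) (d n) : ℝ) + 1 ≤ 2 * ((4 ^ k : ℕ) : ℝ) := by exact_mod_cast h1
    have h3 : 0 < (R ^ (n + 1))⁻¹ := by positivity
    have h4 : 2 * (φ n (A d n) (d n) : ℝ) + 1 ≤ R := by rw [hRM]; linarith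
    nlinarith [mul_le_mul_of_nonneg_right h4 h3.le]
  have hex : ∀ d, ∃ x, ∀ n, A d n ≤ x ∧ x ≤ A d n + (R ^ n)⁻¹ := by
    intro d
    refine ⟨⨆ n, A d n, fun n => ?_⟩
    have := (hmono d).ciSup_mem_iInter_Icc_of_antitone (hanti d)
      (fun n => by simp only; have : 0 < (R ^ n)⁻¹ := by positivity
                   linarith)
    exact mem_iInter.1 this n
  choose g hg using hex
  have hgS : range g ⊆ S := by
    rintro _ ⟨d, rfl⟩
    refine hS _ fun n => (hφ n (A d n) (d n)).2 _ ?_ ?_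
    · rw [← hsucc]; exact (hg d (n + 1)).1
    · rw [← hsucc]; exact (hg d (n + 1)).2
  -- separation
  have hloc : ∀ d e : ℕ → Fin (4 ^ k), ∀ n, (∀ i < n, d i = e i) → A d n = A e n := by
    intro d e n
    induction n with
    | zero => intro _; rfl
    | succ n ih =>
      intro h
      rw [hsucc, hsucc, ih (fun i hi => h i (by omega)), h n (by omega)]
  have hsep : ∀ d e : ℕ → Fin (4 ^ k), ∀ n, (∀ i < n, d i = e i) → d n ≠ e n →
      (R ^ (n + 1))⁻¹ ≤ |g d - g e| := by
    have key : ∀ d e : ℕ → Fin (4 ^ k), ∀ n, (∀ i < n, d i = e i) →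
        φ n (A d n) (d n) < φ n (A d n) (e n) → (R ^ (n + 1))⁻¹ ≤ g e - g d := by
      intro d e n h hlt
      have h1 := (hg d (n + 1)).2
      have h2 := (hg e (n + 1)).1
      rw [hsucc] at h1 h2
      rw [← hloc d e n h] at h2
      have h3 : (φ n (A d n) (d n) : ℝ) + 1 ≤ φ n (A d n) (e n) := by exact_mod_cast hlt
      have h4 : 0 < (R ^ (n + 1))⁻¹ := by positivity
      nlinarith [mul_le_mul_of_nonneg_right h3 h4.le]
    intro d e n h hne
    have hne' : φ n (A d n) (d n) ≠ φ n (A d n) (e n) := fun h' => hne (hinj _ _ h')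
    rcases lt_or_gt_of_ne hne' with hlt | hlt
    · rw [abs_sub_comm]
      exact (key d e n h hlt).trans (le_abs_self _)
    · refine (key e d n (fun i hi => (h i hi).symm) ?_).trans (le_abs_self _)
      rw [← hloc d e n h]; exact hlt
  have hfirst : ∀ d e : ℕ → Fin (4 ^ k), d ≠ e → ∃ n, (∀ i < n, d i = e i) ∧ d n ≠ e n := by
    intro d e hne
    classical
    have : ∃ n, d n ≠ e n := by
      by_contra! hc
      exact hne (funext hc)
    exact ⟨Nat.find this, fun i hi => not_not.1 (Nat.find_min this hi), Nat.find_spec this⟩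
  have hginj : Function.Injective g := by
    intro d e hde
    by_contra hne
    obtain ⟨n, h1, h2⟩ := hfirst d e hne
    have := hsep d e n h1 h2
    rw [hde, sub_self, abs_zero] at this
    have h4 : 0 < (R ^ (n + 1))⁻¹ := by positivity
    linarith
  have hM0 : 0 < 4 ^ k := by positivity
  have : Nonempty (Fin (4 ^ k)) := ⟨⟨0, hM0⟩⟩
  set f : ℝ → ℝ := fun x => Real.ofDigits (Function.invFun g x) with hf
  have hfg : ∀ d, f (g d) = Real.ofDigits d := by
    intro d
    simp only [hf, Function.leftInverse_invFun hginj d]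
  set s : NNReal := (k : NNReal) / (k + 1) with hs
  have hs0 : 0 < s := by
    have : (0 : NNReal) < k := by exact_mod_cast hk
    positivity
  have hsR : (s : ℝ) = (k : ℝ) / (k + 1) := by rw [hs]; push_cast; rfl
  have hRs : R ^ (s : ℝ) = ((4 ^ k : ℕ) : ℝ) := by
    rw [hR, ← Real.rpow_natCast, ← Real.rpow_mul (by norm_num), hsR]
    push_cast
    rw [mul_div_cancel₀ _ (by positivity), Real.rpow_natCast]
  have hhold : HolderOnWith (4 ^ k) s f (range g) := by
    rintro _ ⟨d, rfl⟩ _ ⟨e, rfl⟩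
    by_cases hde : d = e
    · subst hde; simp
    obtain ⟨n, h1, h2⟩ := hfirst d e hde
    have hle := hsep d e n h1 h2
    have hle2 : |Real.ofDigits d - Real.ofDigits e| ≤ 4 ^ k * |g d - g e| ^ (s : ℝ) := by
      refine (Real.abs_ofDigits_sub_ofDigits_le h1).trans ?_
      have h3 : ((R ^ (n + 1))⁻¹) ^ (s : ℝ) ≤ |g d - g e| ^ (s : ℝ) :=
        Real.rpow_le_rpow (by positivity) hle s.2
      have h4 : ((R ^ (n + 1))⁻¹) ^ (s : ℝ) = ((((4 ^ k : ℕ) : ℝ)) ^ (n + 1))⁻¹ := by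
        rw [Real.inv_rpow (by positivity), ← hRs, ← Real.rpow_natCast, ← Real.rpow_mul hR0.le,
          mul_comm, Real.rpow_mul hR0.le, Real.rpow_natCast]
      rw [h4] at h3
      calc ((((4 ^ k : ℕ) : ℝ)) ^ n)⁻¹ = 4 ^ k * ((((4 ^ k : ℕ) : ℝ)) ^ (n + 1))⁻¹ := by
            rw [pow_succ]; push_cast; field_simp
        _ ≤ _ := by gcongr
    rw [hfg, hfg, edist_dist, edist_dist, Real.dist_eq, Real.dist_eq,
      ENNReal.ofReal_rpow_of_nonneg (abs_nonneg (g d - g e)) s.coe_nonneg]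
    refine (ENNReal.ofReal_le_ofReal hle2).trans ?_
    rw [ENNReal.ofReal_mul (by positivity)]
    gcongr
    rw [ENNReal.ofReal_pow (by norm_num)]
    simp
  have himg : Icc (0 : ℝ) 1 ⊆ f '' range g := by
    intro y hy
    obtain ⟨d, -, hd⟩ := Real.ofDigits_SurjOn (b := 4 ^ k)
      (Nat.one_lt_pow (by omega) (by norm_num)) hy
    exact ⟨g d, ⟨d, rfl⟩, by rw [hfg, hd]⟩
  have hdim1 : dimH (Icc (0 : ℝ) 1) = 1 := by
    have := Real.dimH_of_nonempty_interior (s := Icc (0 : ℝ) 1) (by simp)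
    simpa using this
  have h5 : 1 ≤ dimH (range g) / s := by
    rw [← hdim1]
    exact (dimH_mono himg).trans (hhold.dimH_image_le hs0)
  have h6 : (s : ENNReal) ≤ dimH (range g) := by
    rw [ENNReal.le_div_iff_mul_le (Or.inl (by exact_mod_cast hs0.ne')) (Or.inl (by simp))] at h5
    simpa using h5
  exact h6.trans (dimH_mono hgS)

/-- For one denominator, at most three children are bad. -/
theorem bad_card_s15 (R a : ℝ) (hR : 2 ≤ R) (n q N : ℕ) (hq : 0 < q) (h1 : (q : ℝ) ≤ R ^ n)
    (h2 : R ^ n ≤ R * q) (hN : 2 * (N : ℝ) ≤ R) (B : Finset ℕ) (hB : B ⊆ Finset.range N)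
    (hbad : ∀ j ∈ B, ∃ (η : ℝ) (p : ℤ), a + 2 * (j : ℝ) * (R ^ (n + 1))⁻¹ ≤ η ∧
      η ≤ a + 2 * (j : ℝ) * (R ^ (n + 1))⁻¹ + (R ^ (n + 1))⁻¹ ∧ |q * η - p| < 1 / (4 * R ^ 2)) :
    B.card ≤ 3 := by
  classical
  have hq' : (0 : ℝ) < q := by exact_mod_cast hq
  have hR0 : 0 < R := by linarith
  set ρ := (R ^ (n + 1))⁻¹ with hρ
  have hρ0 : 0 < ρ := by positivity
  have hρR : R ^ n * (R * ρ) = 1 := by rw [hρ, pow_succ]; field_simp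
  have hδq : 1 / (4 * R ^ 2) ≤ q * ρ / 4 := by
    rw [div_le_div_iff₀ (by positivity) (by norm_num)]
    have : 1 ≤ (R * q) * (R * ρ) := by
      rw [← hρR]; gcongr
    nlinarith
  have hδ1 : 1 / (4 * R ^ 2) < 1 := by
    rw [div_lt_one (by positivity)]; nlinarith
  choose! η p hb using hbad
  have hmaps : ∀ j ∈ B, p j ∈ Finset.Icc ⌊(q : ℝ) * a⌋ (⌊(q : ℝ) * a⌋ + 2) := by
    intro j hj
    obtain ⟨e1, e2, e3⟩ := hb j hj
    rw [abs_lt] at e3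
    have hjN : (j : ℝ) + 1 ≤ N := by exact_mod_cast Finset.mem_range.1 (hB hj)
    have e4 : a ≤ η j := by
      have : 0 ≤ 2 * (j : ℝ) * ρ := by positivity
      linarith
    have e5 : η j ≤ a + R * ρ := by
      have : (2 * (j : ℝ) + 1) * ρ ≤ R * ρ := by
        apply mul_le_mul_of_nonneg_right _ hρ0.le; linarith
      linarith
    have e6 : q * a ≤ q * η j := by gcongr
    have e7 : q * η j ≤ q * a + 1 := by
      calc q * η j ≤ q * (a + R * ρ) := by gcongr
        _ = q * a + q * (R * ρ) := by ring
        _ ≤ q * a + R ^ n * (R * ρ) := by gcongr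
        _ = _ := by rw [hρR]
    have f1 := Int.floor_le ((q : ℝ) * a)
    have f2 := Int.lt_floor_add_one ((q : ℝ) * a)
    rw [Finset.mem_Icc]
    constructor
    · have : ((⌊(q : ℝ) * a⌋ : ℤ) : ℝ) < ((p j + 1 : ℤ) : ℝ) := by push_cast; linarith
      have := Int.cast_lt.1 this
      omega
    · have : ((p j : ℤ) : ℝ) < ((⌊(q : ℝ) * a⌋ + 3 : ℤ) : ℝ) := by push_cast; linarith
      have := Int.cast_lt.1 this
      omega
  have key : ∀ i ∈ B, ∀ j ∈ B, p i = p j → ¬ i < j := by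
    intro i hi j hj hp hlt
    obtain ⟨e1, e2, e3⟩ := hb i hi
    obtain ⟨g1, g2, g3⟩ := hb j hj
    rw [hp] at e3
    rw [abs_lt] at e3 g3
    have h3 : (i : ℝ) + 1 ≤ j := by exact_mod_cast hlt
    have h4 : ρ ≤ η j - η i := by
      nlinarith [mul_le_mul_of_nonneg_right h3 hρ0.le]
    have h5 : q * ρ ≤ q * (η j - η i) := by gcongr
    have : 0 < q * ρ := by positivity
    nlinarith
  have := Finset.card_le_card_of_injOn p hmaps (by
    intro i hi j hj hp
    have k1 := key i hi j hj hp
    have k2 := key j hj i hi hp.symm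
    omega)
  rw [Int.card_Icc] at this
  omega

/-- The choice of good children for two denominators. -/
theorem good_children (k : ℕ) (hk : 2 ≤ k) (n : ℕ) (a : ℝ) (q : Fin 2 → ℕ) :
    ∃ φ : Fin (4 ^ k) → ℕ, Function.Injective φ ∧ ∀ j, φ j < 2 * 4 ^ k ∧
      ∀ η : ℝ, a + 2 * (φ j : ℝ) * (((4 : ℝ) ^ (k + 1)) ^ (n + 1))⁻¹ ≤ η →
        η ≤ a + 2 * (φ j : ℝ) * (((4 : ℝ) ^ (k + 1)) ^ (n + 1))⁻¹
          + (((4 : ℝ) ^ (k + 1)) ^ (n + 1))⁻¹ →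
        ∀ i, 0 < q i → (q i : ℝ) ≤ ((4 : ℝ) ^ (k + 1)) ^ n →
          ((4 : ℝ) ^ (k + 1)) ^ n ≤ (4 : ℝ) ^ (k + 1) * q i →
          ∀ p : ℤ, 1 / (4 * ((4 : ℝ) ^ (k + 1)) ^ 2) ≤ |q i * η - p| := by
  classical
  set R : ℝ := (4 : ℝ) ^ (k + 1) with hR
  have h16 : 16 ≤ 4 ^ k := by
    calc 16 = 4 ^ 2 := by norm_num
      _ ≤ 4 ^ k := Nat.pow_le_pow_right (by norm_num) hk
  have hRM : R = 4 * ((4 ^ k : ℕ) : ℝ) := by push_cast; rw [hR]; ring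
  have hR2 : 2 ≤ R := by
    have : (16 : ℝ) ≤ ((4 ^ k : ℕ) : ℝ) := by exact_mod_cast h16
    rw [hRM]; linarith
  let Bad : Fin 2 → Finset ℕ := fun i => (Finset.range (2 * 4 ^ k)).filter fun j =>
    (0 < q i ∧ (q i : ℝ) ≤ R ^ n ∧ R ^ n ≤ R * q i) ∧
    ∃ (η : ℝ) (p : ℤ), a + 2 * (j : ℝ) * (R ^ (n + 1))⁻¹ ≤ η ∧
      η ≤ a + 2 * (j : ℝ) * (R ^ (n + 1))⁻¹ + (R ^ (n + 1))⁻¹ ∧ |q i * η - p| < 1 / (4 * R ^ 2)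
  have hBad : ∀ i, (Bad i).card ≤ 3 := by
    intro i
    by_cases hc : 0 < q i ∧ (q i : ℝ) ≤ R ^ n ∧ R ^ n ≤ R * q i
    · refine bad_card_s15 R a hR2 n (q i) (2 * 4 ^ k) hc.1 hc.2.1 hc.2.2 ?_ (Bad i)
        (Finset.filter_subset _ _) ?_
      · rw [hRM]; push_cast; linarith
      · intro j hj
        exact (Finset.mem_filter.1 hj).2.2
    · have : Bad i = ∅ := by
        apply Finset.filter_false_of_mem
        intro j _ h
        exact hc h.1
      rw [this]; simp
  set G := Finset.range (2 * 4 ^ k) \ (Bad 0 ∪ Bad 1) with hG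
  have hGc : 4 ^ k ≤ G.card := by
    have h1 := Finset.le_card_sdiff (Bad 0 ∪ Bad 1) (Finset.range (2 * 4 ^ k))
    have h2 := Finset.card_union_le (Bad 0) (Bad 1)
    have h3 := hBad 0
    have h4 := hBad 1
    rw [Finset.card_range, ← hG] at h1
    omega
  refine ⟨fun j => G.orderEmbOfFin rfl (Fin.castLE hGc j), ?_, ?_⟩
  · intro i j hij
    simpa using hij
  · intro j
    simp only
    set m := G.orderEmbOfFin rfl (Fin.castLE hGc j) with hm
    have hmG : m ∈ G := Finset.orderEmbOfFin_mem _ _ _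
    rw [hG, Finset.mem_sdiff, Finset.mem_union, not_or] at hmG
    refine ⟨Finset.mem_range.1 hmG.1, ?_⟩
    intro η h1 h2 i c1 c2 c3 p
    by_contra! hlt
    have hmb : m ∈ Bad i := Finset.mem_filter.2 ⟨hmG.1, ⟨c1, c2, c3⟩, η, p, h1, h2, hlt⟩
    fin_cases i
    · exact hmG.2.1 hmb
    · exact hmG.2.2 hmb

/-- Two good approximations of large order with small denominators coincide. -/
theorem approx_eq (θ : ℝ) (R : ℕ) (hR : 2 ≤ R) (r r' : ℚ) (n s t : ℕ) (hs : n + 1 ≤ s)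
    (ht : n + 1 ≤ t)
    (h : |θ - r| ≤ 1 / (((R ^ s : ℕ) + 1) * r.den)) (h' : |θ - r'| ≤ 1 / (((R ^ t : ℕ) + 1) * r'.den))
    (hd : r.den ≤ R ^ n) (hd' : r'.den ≤ R ^ n) : r = r' := by
  by_contra hne
  have hsub : r - r' ≠ 0 := sub_ne_zero.2 hne
  have d0 : (0 : ℝ) < r.den := by exact_mod_cast r.den_pos
  have d0' : (0 : ℝ) < r'.den := by exact_mod_cast r'.den_pos
  have hlow : 1 ≤ |((r : ℝ) - r') * (r.den * r'.den)| := by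
    have e : ((r : ℝ) - r') * (r.den * r'.den) =
        ((r.num * r'.den - r'.num * r.den : ℤ) : ℝ) := by
      have e1 : (r : ℝ) * r.den = r.num := by exact_mod_cast Rat.mul_den_eq_num r
      have e2 : (r' : ℝ) * r'.den = r'.num := by exact_mod_cast Rat.mul_den_eq_num r'
      push_cast
      rw [← e1, ← e2]; ring
    have hz : (r.num * r'.den - r'.num * r.den : ℤ) ≠ 0 := by
      intro hz
      rw [hz, Int.cast_zero] at e
      have : (r : ℝ) - r' ≠ 0 := by exact_mod_cast hsub
      have : ((r : ℝ) - r') * (r.den * r'.den) ≠ 0 := by positivity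
      exact this e
    rw [e]
    exact_mod_cast Int.one_le_abs hz
  rw [abs_mul, abs_of_pos (mul_pos d0 d0')] at hlow
  have htri : |(r : ℝ) - r'| ≤ 1 / (((R ^ s : ℕ) + 1) * r.den) + 1 / (((R ^ t : ℕ) + 1) * r'.den) := by
    calc |(r : ℝ) - r'| = |(θ - r') - (θ - r)| := by ring_nf
      _ ≤ |θ - r'| + |θ - r| := abs_sub _ _
      _ ≤ _ := by linarith
  have haux : ∀ u, n + 1 ≤ u → ∀ d : ℕ, d ≤ R ^ n → (d : ℝ) / ((R ^ u : ℕ) + 1) < 1 / 2 := by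
    intro u hu d hd
    rw [div_lt_div_iff₀ (by positivity) (by norm_num)]
    have h1 : 2 * d ≤ R ^ u := by
      calc 2 * d ≤ R * R ^ n := Nat.mul_le_mul hR hd
        _ = R ^ (n + 1) := by ring
        _ ≤ R ^ u := Nat.pow_le_pow_right (by omega) hu
    have h2 : 2 * (d : ℝ) ≤ (R ^ u : ℕ) := by exact_mod_cast h1
    linarith
  have h1 := haux s hs _ hd'
  have h2 := haux t ht _ hd
  have : |(r : ℝ) - r'| * (r.den * r'.den) ≤
      (r'.den : ℝ) / ((R ^ s : ℕ) + 1) + (r.den : ℝ) / ((R ^ t : ℕ) + 1) := by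
    refine (mul_le_mul_of_nonneg_right htri (by positivity)).trans (le_of_eq ?_)
    field_simp
  linarith

/-- The transference step. -/
theorem transfer (θ η δ : ℝ) (hδ : 0 < δ) (hδ1 : δ ≤ 1) (R : ℕ) (hR : 2 ≤ R) (r : ℕ → ℚ)
    (h : ∀ t, |θ - r t| ≤ 1 / (((R ^ t : ℕ) + 1) * (r t).den)) (hd : ∀ t, (r t).den ≤ R ^ t)
    (hη : ∀ t (p : ℤ), δ ≤ |(r t).den * η - p|) :
    0 < ⨅ x : {x : ℤ // x ≠ 0}, (|x.val| : ℝ) * dnint (θ * (x.val : ℝ) + η) := by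
  have hR' : (2 : ℝ) ≤ R := by exact_mod_cast hR
  have hpos : 0 < δ ^ 2 / (4 * R) := by positivity
  refine hpos.trans_le ?_
  have : Nonempty {x : ℤ // x ≠ 0} := ⟨⟨1, one_ne_zero⟩⟩
  refine le_ciInf fun x => ?_
  obtain ⟨x, hx⟩ := x
  simp only
  have hx1 : (1 : ℝ) ≤ |(x : ℝ)| := by exact_mod_cast Int.one_le_abs hx
  have hx0 : (0 : ℝ) < |(x : ℝ)| := by linarith
  obtain ⟨t, ht1, ht2⟩ := exists_nat_pow_near (x := 2 * |(x : ℝ)| / δ) (y := (R : ℝ))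
    (by rw [le_div_iff₀ hδ]; linarith) (by linarith)
  set q : ℕ := (r (t + 1)).den with hq
  have q0 : (0 : ℝ) < q := by exact_mod_cast (r (t + 1)).den_pos
  have hqle : (q : ℝ) ≤ R * (2 * |(x : ℝ)| / δ) := by
    have : (q : ℝ) ≤ (R : ℝ) ^ (t + 1) := by exact_mod_cast hd (t + 1)
    refine this.trans ?_
    rw [pow_succ, mul_comm]
    gcongr
  have hmain : δ / (2 * q) ≤ dnint (θ * (x : ℝ) + η) := by
    refine le_ciInf fun m => ?_
    have e0 : (r (t + 1) : ℝ) * q = (r (t + 1)).num := by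
      exact_mod_cast Rat.mul_den_eq_num (r (t + 1))
    have e1 := hη (t + 1) (q * m - x * (r (t + 1)).num)
    rw [← hq] at e1
    have e2 : |(x : ℝ) * (q * (θ - r (t + 1)))| ≤ δ / 2 := by
      rw [abs_mul, abs_mul, abs_of_pos q0]
      have h3 := h (t + 1)
      rw [← hq] at h3
      calc |(x : ℝ)| * (q * |θ - r (t + 1)|)
          ≤ |(x : ℝ)| * (q * (1 / (((R ^ (t + 1) : ℕ) + 1) * q))) := by gcongr
        _ = |(x : ℝ)| / ((R ^ (t + 1) : ℕ) + 1) := by field_simp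
        _ ≤ δ / 2 := by
          rw [div_le_div_iff₀ (by positivity) (by norm_num)]
          rw [div_lt_iff₀ hδ] at ht2
          push_cast
          nlinarith
    have e3 : (q : ℝ) * η - ((q * m - x * (r (t + 1)).num : ℤ) : ℝ) =
        q * (θ * x + η - m) - x * (q * (θ - r (t + 1))) := by
      push_cast
      rw [← e0]; ring
    rw [e3] at e1
    have e4 := abs_sub (q * (θ * x + η - m)) (x * (q * (θ - r (t + 1))))
    rw [abs_mul (q : ℝ), abs_of_pos q0] at e4
    rw [div_le_iff₀ (by positivity)]
    nlinarith
  calc δ ^ 2 / (4 * R) ≤ |(x : ℝ)| * (δ / (2 * q)) := by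
        rw [← mul_div_assoc, div_le_div_iff₀ (by positivity) (by positivity)]
        rw [← mul_div_assoc, le_div_iff₀ hδ] at hqle
        nlinarith
    _ ≤ _ := by
        exact mul_le_mul_of_nonneg_left hmain hx0.le

theorem dim_lower (θ : ℝ) (k : ℕ) (hk : 2 ≤ k) :
    (((k : NNReal) / (k + 1) : NNReal) : ENNReal) ≤ dimH {η : ℝ |
        0 < ⨅ x : {x : ℤ // x ≠ 0}, (|x.val| : ℝ) * dnint (θ * (x.val : ℝ) + η)} := by
  set R : ℕ := 4 ^ (k + 1) with hR
  have hR2 : 2 ≤ R := by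
    calc 2 ≤ 4 ^ 1 := by norm_num
      _ ≤ 4 ^ (k + 1) := Nat.pow_le_pow_right (by norm_num) (by omega)
  have hRc : (R : ℝ) = (4 : ℝ) ^ (k + 1) := by rw [hR]; push_cast; rfl
  have hR2' : (2 : ℝ) ≤ R := by exact_mod_cast hR2
  have hex : ∀ t : ℕ, ∃ r : ℚ, |θ - r| ≤ 1 / (((R ^ t : ℕ) + 1) * r.den) ∧ r.den ≤ R ^ t :=
    fun t => Real.exists_rat_abs_sub_le_and_den_le θ (by positivity)
  choose r hr hrd using hex
  have hu : ∀ n : ℕ, ∃ u : ℚ, ∀ t, n + 1 ≤ t → (r t).den ≤ R ^ n → r t = u := by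
    intro n
    by_cases hc : ∃ t, n + 1 ≤ t ∧ (r t).den ≤ R ^ n
    · obtain ⟨t', h1, h2⟩ := hc
      exact ⟨r t', fun t h3 h4 => approx_eq θ R hR2 _ _ n t t' h3 h1 (hr _) (hr _) h4 h2⟩
    · exact ⟨0, fun t h3 h4 => (hc ⟨t, h3, h4⟩).elim⟩
  choose u hu using hu
  refine cantor_dim k (by omega) _ _
    (fun n a => good_children k hk n a ![(r n).den, (u n).den]) ?_
  intro η hη
  refine transfer θ η (1 / (4 * ((4 : ℝ) ^ (k + 1)) ^ 2)) (by positivity) ?_ R hR2 r hr hrd ?_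
  · rw [← hRc, div_le_one (by positivity)]; nlinarith
  intro t p
  rw [← hRc] at hη ⊢
  have hd1 : (1 : ℝ) ≤ (r t).den := by exact_mod_cast (r t).den_pos
  -- find the level
  have hlev : ∃ n : ℕ, ((r t).den : ℝ) ≤ (R : ℝ) ^ n ∧ (R : ℝ) ^ n ≤ R * (r t).den ∧ n ≤ t := by
    classical
    have hex : ∃ n, (r t).den ≤ R ^ n := ⟨t, hrd t⟩
    refine ⟨Nat.find hex, by exact_mod_cast Nat.find_spec hex, ?_, Nat.find_min' hex (hrd t)⟩
    rcases hn : Nat.find hex with _ | m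
    · rw [pow_zero]; nlinarith
    · have := Nat.find_min hex (m := m) (by omega)
      have h1 : R ^ m ≤ (r t).den := by omega
      have h2 : (R : ℝ) ^ m ≤ (r t).den := by exact_mod_cast h1
      rw [pow_succ, mul_comm]
      gcongr
  obtain ⟨n, h1, h2, h3⟩ := hlev
  rcases h3.eq_or_lt with h4 | h4
  · have := hη n 0
    simp only [Matrix.cons_val_zero] at this
    subst h4
    exact this (r n).den_pos h1 h2 p
  · have h1' : (r t).den ≤ R ^ n := by exact_mod_cast h1
    have hη' := hη n 1
    simp only [Matrix.cons_val_one, Matrix.cons_val_fin_one] at hη'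
    rw [← hu n t h4 h1'] at hη'
    exact hη' (r t).den_pos h1 h2 p

/-- Tseng's theorem (dimension consequence): for any real `θ`, the set of
`η ∈ ℝ` with `inf_{x ∈ ℤ \ {0}} |x| ⬝ ‖θx + η‖ > 0` has full Hausdorff
dimension `1`. -/
theorem tseng_full_dimension (θ : ℝ) :
    dimH {η : ℝ |
        0 < ⨅ x : {x : ℤ // x ≠ 0}, (|x.val| : ℝ) * dnint (θ * (x.val : ℝ) + η)} = 1 := by
  apply le_antisymm
  · rw [← Real.dimH_univ]
    exact dimH_mono (Set.subset_univ _)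
  · have hlim : Filter.Tendsto (fun k : ℕ => (((k : NNReal) / (k + 1) : NNReal) : ENNReal))
        Filter.atTop (nhds 1) := by
      rw [← ENNReal.coe_one, ENNReal.tendsto_coe, ← NNReal.tendsto_coe]
      have := tendsto_natCast_div_add_atTop (𝕜 := ℝ) 1
      push_cast
      exact this
    refine le_of_tendsto hlim ?_
    filter_upwards [Filter.eventually_ge_atTop 2] with k hk
    exact dim_lower θ k hk
end
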